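/- arXiv:2301.02067 — 2 statements merged into one kernel-verified Lean document; each statement's English description precedes it below -/
import Mathlib

section
/- Let d ≥ 1, m ≥ 1, d < p < ∞ with p ≥ 2, and Λ > 0. There exist ε > 0 and C < ∞ (depending only on d, m, p, Λ) such that for every u₀ : ℝ^d → ℝ^m with ‖u₀‖_{Ḃ^{d/p}_{p,∞}} < ε and every mild solution u : ℝ^d × (0,∞) → ℝ^m of the harmonic map heat flow with initial data u₀ and forcing bound Λ, such that t ↦ t^{1/2 - d/(2p)} ∇u(t) is continuous from [0,∞) to L^p(ℝ^d) with t^{1/2 - d/(2p)}‖∇u(t)‖_{L^p} → 0 as t ↘ 0, one has sup_{t>0} t^{1/2} ‖∇u(t)‖_{L^∞(ℝ^d)} + sup_{x∈ℝ^d} sup_{0<R<∞} R^{-d/2} ‖∇u‖_{L²(B_R(x)×(0,R²))} ≤ C ‖u₀‖_{Ḃ^{d/p}_{p,∞}}. -/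
noncomputable section

open MeasureTheory Real Set Filter
open scoped ENNReal

/-- `ℝ^d` as a Euclidean space. -/
abbrev Ed (d : ℕ) : Type := EuclideanSpace ℝ (Fin d)

/-- The heat kernel `G(x,t) = (4πt)^{-d/2} e^{-|x|²/(4t)}` on `ℝ^d`. -/
def heatKernel (d : ℕ) (t : ℝ) (x : Ed d) : ℝ :=
  (4 * Real.pi * t) ^ (-(d : ℝ) / 2) * Real.exp (-‖x‖ ^ 2 / (4 * t))

/-- Heat extension `G(t) f = G(·,t) ⋆ f`. -/
def heatConv {F : Type} [NormedAddCommGroup F] [NormedSpace ℝ F] (d : ℕ) (t : ℝ)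
    (v : Ed d → F) : Ed d → F :=
  fun x => ∫ y, heatKernel d t (x - y) • v y

/-- The homogeneous Besov norm
`‖v‖_{Ḃ^{d/p}_{p,∞}} = sup_{t>0} t^{1/2-d/(2p)} ‖∇(G(t)v)‖_{L^p}`. -/
def besovNorm (d m : ℕ) (p : ℝ) (v : Ed d → Ed m) : ℝ≥0∞ :=
  ⨆ t : Set.Ioi (0 : ℝ),
    ENNReal.ofReal ((t : ℝ) ^ ((1 : ℝ) / 2 - d / (2 * p))) *
      eLpNorm (fun x => fderiv ℝ (heatConv d (t : ℝ) v) x) (ENNReal.ofReal p) volume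

/-- `u : ℝ^d × (0,∞) → ℝ^m` (time variable first) is a mild solution of the harmonic map
heat flow with initial data `u₀` and forcing bound `Λ`. -/
def IsMildSolution (d m : ℕ) (Λ : ℝ) (u₀ : Ed d → Ed m) (u : ℝ → Ed d → Ed m) : Prop :=
  ∃ f : ℝ → Ed d → Ed m,
    Measurable (Function.uncurry f) ∧
    (∀ s : ℝ, 0 < s → ∀ x : Ed d, ‖f s x‖ ≤ Λ * ‖fderiv ℝ (u s) x‖ ^ 2) ∧
    (∀ t : ℝ, 0 < t → ∀ x : Ed d,
      u t x = heatConv d t u₀ x + ∫ s in Set.Ioo (0 : ℝ) t, heatConv d (t - s) (f s) x)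

/-- The space-time `L²` norm of a (time-first) function over the parabolic cylinder
`B_R(x) × (0,R²)`. -/
def cylinderL2 (d : ℕ) {F : Type} [NormedAddCommGroup F]
    (w : ℝ → Ed d → F) (x : Ed d) (R : ℝ) : ℝ≥0∞ :=
  eLpNorm (fun q : ℝ × Ed d => w q.1 q.2) 2
    (((volume : Measure ℝ).restrict (Set.Ioo 0 (R ^ 2))).prod
      ((volume : Measure (Ed d)).restrict (Metric.ball x R)))

/-- The condition that `t ↦ t^{1/2-d/(2p)} ∇u(t)` is continuous from `[0,∞)` to `L^p(ℝ^d)`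
and tends to `0` in `L^p` as `t ↘ 0`. -/
def GradContinuousVanishing (d m : ℕ) (p : ℝ) (hp : 1 ≤ p) (u : ℝ → Ed d → Ed m) : Prop :=
  haveI : Fact (1 ≤ ENNReal.ofReal p) := ⟨by simpa using ENNReal.ofReal_le_ofReal hp⟩
  ∃ g : ℝ → Lp (Ed d →L[ℝ] Ed m) (ENNReal.ofReal p) (volume : Measure (Ed d)),
    ContinuousOn g (Set.Ici 0) ∧ g 0 = 0 ∧
      ∀ t : ℝ, 0 < t →
        (g t : Ed d → Ed d →L[ℝ] Ed m) =ᵐ[volume]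
          fun x => (t ^ ((1 : ℝ) / 2 - d / (2 * p))) • fderiv ℝ (u t) x

theorem lintegral_mul_rpow_le {α : Type*} [MeasurableSpace α] {μ : Measure α} {a : ℝ} (ha : 1 ≤ a)
    {K g : α → ℝ≥0∞} (hK : AEMeasurable K μ) (hg : AEMeasurable g μ) :
    (∫⁻ x, K x * g x ∂μ) ^ a ≤ (∫⁻ x, K x ∂μ) ^ (a - 1) * ∫⁻ x, K x * g x ^ a ∂μ := by
  have ha0 : 0 < a := by linarith
  have hp : 0 ≤ 1 - 1 / a := by
    have : 1 / a ≤ 1 := by rw [div_le_one ha0]; exact ha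
    linarith
  have hq : 0 ≤ 1 / a := by positivity
  have h := ENNReal.lintegral_mul_norm_pow_le (μ := μ) hK (hK.mul (hg.pow_const a)) hp hq (by ring)
  have e : ∀ x, K x ^ (1 - 1 / a) * ((K * fun x => g x ^ a) x) ^ (1 / a) = K x * g x := by
    intro x
    simp only [Pi.mul_apply]
    rw [ENNReal.mul_rpow_of_nonneg _ _ hq, ← mul_assoc, ← ENNReal.rpow_add_of_nonneg _ _ hp hq,
      ← ENNReal.rpow_mul]
    rw [mul_one_div_cancel ha0.ne']
    simp
  simp only [e] at h
  calc _ ≤ _ := ENNReal.rpow_le_rpow h ha0.le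
    _ = _ := by
      rw [ENNReal.mul_rpow_of_nonneg _ _ ha0.le, ← ENNReal.rpow_mul, ← ENNReal.rpow_mul]
      rw [one_div_mul_cancel ha0.ne', ENNReal.rpow_one]
      congr 2
      field_simp

theorem lintegral_conv_le {d : ℕ} {a : ℝ} (ha : 1 ≤ a) {K g : Ed d → ℝ≥0∞} (hK : Measurable K)
    (hg : AEMeasurable g volume) {c κ m : ℝ≥0∞} (hc : ∫⁻ x, K x ≤ c) (hκ : ∀ x, K x ≤ c * κ)
    (hm : ∫⁻ x, g x ^ a ≤ m ^ a) (x : Ed d) :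
    ∫⁻ y, K (x - y) * g y ≤ c * m * κ ^ (1 / a) := by
  have ha0 : 0 < a := by linarith
  have hKx : Measurable fun y => K (x - y) := hK.comp (measurable_const.sub measurable_id)
  have h := lintegral_mul_rpow_le ha (μ := volume) hKx.aemeasurable hg
  rw [lintegral_sub_left_eq_self] at h
  have h2 : (∫⁻ y, K (x - y) * g y) ^ a ≤ (c * m * κ ^ (1 / a)) ^ a := by
    calc _ ≤ _ := h
      _ ≤ c ^ (a - 1) * ∫⁻ y, (c * κ) * g y ^ a := by
        gcongr
        exact hκ _
      _ = c ^ (a - 1) * ((c * κ) * ∫⁻ y, g y ^ a) := by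
        rw [lintegral_const_mul'' _ (hg.pow_const a)]
      _ ≤ c ^ (a - 1) * ((c * κ) * m ^ a) := by gcongr
      _ = (c ^ (a - 1) * c ^ (1 : ℝ)) * (m ^ a * κ) := by rw [ENNReal.rpow_one]; ring
      _ = _ := by
        rw [← ENNReal.rpow_add_of_nonneg _ _ (by linarith) zero_le_one,
          ENNReal.mul_rpow_of_nonneg _ _ ha0.le, ENNReal.mul_rpow_of_nonneg _ _ ha0.le,
          ← ENNReal.rpow_mul, one_div_mul_cancel ha0.ne', ENNReal.rpow_one, sub_add_cancel]
        ring
  exact (ENNReal.rpow_le_rpow_iff ha0).1 h2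

theorem lintegral_conv_rpow_self_le {d : ℕ} {a : ℝ} (ha : 1 ≤ a) {K g : Ed d → ℝ≥0∞}
    (hK : Measurable K) (hg : Measurable g) {c m : ℝ≥0∞} (hc : ∫⁻ x, K x ≤ c)
    (hm : ∫⁻ x, g x ^ a ≤ m ^ a) :
    ∫⁻ x, (∫⁻ y, K (x - y) * g y) ^ a ≤ (c * m) ^ a := by
  have ha0 : 0 < a := by linarith
  have hK2 : Measurable fun q : Ed d × Ed d => K (q.1 - q.2) :=
    hK.comp (measurable_fst.sub measurable_snd)
  have hm2 : Measurable fun q : Ed d × Ed d => K (q.1 - q.2) * g q.2 ^ a :=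
    hK2.mul ((hg.comp measurable_snd).pow_const a)
  calc _ ≤ ∫⁻ x, c ^ (a - 1) * ∫⁻ y, K (x - y) * g y ^ a := by
        refine lintegral_mono fun x => ?_
        have hKx : Measurable fun y => K (x - y) := hK.comp (measurable_const.sub measurable_id)
        have h := lintegral_mul_rpow_le ha (μ := volume) hKx.aemeasurable hg.aemeasurable
        rw [lintegral_sub_left_eq_self] at h
        refine h.trans ?_
        gcongr
    _ = c ^ (a - 1) * ∫⁻ x, ∫⁻ y, K (x - y) * g y ^ a :=
        lintegral_const_mul _ hm2.lintegral_prod_right'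
    _ = c ^ (a - 1) * ∫⁻ y, (∫⁻ x, K x) * g y ^ a := by
        rw [lintegral_lintegral_swap hm2.aemeasurable]
        congr 1
        refine lintegral_congr fun y => ?_
        have hKy : Measurable fun x => K (x - y) := hK.comp (measurable_id.sub measurable_const)
        rw [lintegral_mul_const _ hKy]
        congr 1
        exact lintegral_sub_right_eq_self K y
    _ = c ^ (a - 1) * ((∫⁻ x, K x) * ∫⁻ y, g y ^ a) := by
        rw [lintegral_const_mul _ (hg.pow_const a)]
    _ ≤ c ^ (a - 1) * (c * m ^ a) := by gcongr
    _ = (c ^ (a - 1) * c ^ (1 : ℝ)) * m ^ a := by rw [ENNReal.rpow_one]; ring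
    _ = _ := by
        rw [← ENNReal.rpow_add_of_nonneg _ _ (by linarith) zero_le_one,
          ENNReal.mul_rpow_of_nonneg _ _ ha0.le, sub_add_cancel]

theorem lintegral_conv_rpow_le {d : ℕ} {a q : ℝ} (ha : 1 ≤ a) (haq : a ≤ q) {K g : Ed d → ℝ≥0∞}
    (hK : Measurable K) (hg : Measurable g) {c κ m : ℝ≥0∞} (hc : ∫⁻ x, K x ≤ c)
    (hκ : ∀ x, K x ≤ c * κ) (hm : ∫⁻ x, g x ^ a ≤ m ^ a) :
    ∫⁻ x, (∫⁻ y, K (x - y) * g y) ^ q ≤ (c * m * κ ^ (1 / a - 1 / q)) ^ q := by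
  have ha0 : 0 < a := by linarith
  have hq0 : 0 < q := by linarith
  have hqa : 0 ≤ q - a := by linarith
  have hK2 : Measurable fun q : Ed d × Ed d => K (q.1 - q.2) :=
    hK.comp (measurable_fst.sub measurable_snd)
  have hm2 : Measurable fun q : Ed d × Ed d => K (q.1 - q.2) * g q.2 :=
    hK2.mul (hg.comp measurable_snd)
  have hms : Measurable fun x => ∫⁻ y, K (x - y) * g y := hm2.lintegral_prod_right'
  calc _ ≤ ∫⁻ x, (c * m * κ ^ (1 / a)) ^ (q - a) * (∫⁻ y, K (x - y) * g y) ^ a := by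
        refine lintegral_mono fun x => ?_
        have h := lintegral_conv_le ha hK hg.aemeasurable hc hκ hm x
        calc (∫⁻ y, K (x - y) * g y) ^ q
            = (∫⁻ y, K (x - y) * g y) ^ (q - a) * (∫⁻ y, K (x - y) * g y) ^ a := by
              rw [← ENNReal.rpow_add_of_nonneg _ _ hqa ha0.le, sub_add_cancel]
          _ ≤ _ := by gcongr
    _ = (c * m * κ ^ (1 / a)) ^ (q - a) * ∫⁻ x, (∫⁻ y, K (x - y) * g y) ^ a :=
        lintegral_const_mul _ (hms.pow_const a)
    _ ≤ (c * m * κ ^ (1 / a)) ^ (q - a) * (c * m) ^ a := by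
        gcongr
        exact lintegral_conv_rpow_self_le ha hK hg hc hm
    _ = ((c * m) ^ (q - a) * (c * m) ^ a) * κ ^ (1 / a * (q - a)) := by
        rw [ENNReal.mul_rpow_of_nonneg _ _ hqa, ← ENNReal.rpow_mul]; ring
    _ = _ := by
        rw [← ENNReal.rpow_add_of_nonneg _ _ hqa ha0.le, sub_add_cancel,
          ENNReal.mul_rpow_of_nonneg (c * m) (κ ^ _) hq0.le, ← ENNReal.rpow_mul κ (1 / a - 1 / q) q]
        congr 2
        field_simp

/-- A form of Minkowski's integral inequality. -/
theorem lintegral_lintegral_rpow_le {α β : Type*} [MeasurableSpace α] [MeasurableSpace β]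
    {μ : Measure α} {ν : Measure β} [SFinite μ] [SFinite ν] {q : ℝ} (hq : 1 ≤ q)
    {F : α → β → ℝ≥0∞} (hF : Measurable (Function.uncurry F)) {ω : α → ℝ≥0∞} (hω : Measurable ω)
    (hω0 : ∀ᵐ s ∂μ, ω s ≠ 0) (hωt : ∀ᵐ s ∂μ, ω s ≠ ∞)
    (h : ∀ᵐ s ∂μ, ∫⁻ x, F s x ^ q ∂ν ≤ ω s ^ q) :
    ∫⁻ x, (∫⁻ s, F s x ∂μ) ^ q ∂ν ≤ (∫⁻ s, ω s ∂μ) ^ q := by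
  have hq0 : 0 < q := by linarith
  have hFx : ∀ x, Measurable fun s => F s x := fun x => hF.comp (measurable_id.prodMk measurable_const)
  have hFs : ∀ s, Measurable fun x => F s x := fun s => hF.comp (measurable_const.prodMk measurable_id)
  have hm : Measurable fun z : β × α => ω z.2 * (F z.2 z.1 / ω z.2) ^ q :=
    (hω.comp measurable_snd).mul
      (((hF.comp measurable_swap).div (hω.comp measurable_snd)).pow_const q)
  calc _ ≤ ∫⁻ x, (∫⁻ s, ω s ∂μ) ^ (q - 1) * ∫⁻ s, ω s * (F s x / ω s) ^ q ∂μ ∂ν := by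
        refine lintegral_mono fun x => ?_
        refine le_trans (le_of_eq ?_)
          (lintegral_mul_rpow_le hq hω.aemeasurable ((hFx x).div hω).aemeasurable)
        congr 1
        refine lintegral_congr_ae ?_
        filter_upwards [hω0, hωt] with s h0 ht
        exact (ENNReal.mul_div_cancel h0 ht).symm
    _ = (∫⁻ s, ω s ∂μ) ^ (q - 1) * ∫⁻ x, ∫⁻ s, ω s * (F s x / ω s) ^ q ∂μ ∂ν :=
        lintegral_const_mul _ hm.lintegral_prod_right'
    _ = (∫⁻ s, ω s ∂μ) ^ (q - 1) * ∫⁻ s, ∫⁻ x, ω s * (F s x / ω s) ^ q ∂ν ∂μ := by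
        rw [lintegral_lintegral_swap hm.aemeasurable]
    _ ≤ (∫⁻ s, ω s ∂μ) ^ (q - 1) * ∫⁻ s, ω s ∂μ := by
        gcongr 1
        refine lintegral_mono_ae ?_
        filter_upwards [hω0, hωt, h] with s h0 ht hs
        rw [lintegral_const_mul _ (((hFs s).div_const _).pow_const q)]
        simp only [ENNReal.div_rpow_of_nonneg _ _ hq0.le]
        simp only [div_eq_mul_inv]
        rw [lintegral_mul_const _ ((hFs s).pow_const q)]
        have h1 : ω s ^ q ≠ 0 := by simp [ENNReal.rpow_eq_zero_iff, h0, ht]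
        have h2 : ω s ^ q ≠ ∞ := by simp [ENNReal.rpow_eq_top_iff, h0, ht]
        calc _ ≤ ω s * (ω s ^ q * (ω s ^ q)⁻¹) := by gcongr
          _ = ω s := by rw [ENNReal.mul_inv_cancel h1 h2, mul_one]
    _ = _ := by
        conv_lhs => rw [← ENNReal.rpow_one (∫⁻ s, ω s ∂μ), ← ENNReal.rpow_mul, one_mul]
        rw [← ENNReal.rpow_add_of_nonneg _ _ (by linarith) zero_le_one, sub_add_cancel]

theorem heatKernel_pos {d : ℕ} {t : ℝ} (ht : 0 < t) (x : Ed d) : 0 < heatKernel d t x := by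
  unfold heatKernel; positivity

theorem heatKernel_le {d : ℕ} {t : ℝ} (ht : 0 < t) (x : Ed d) :
    heatKernel d t x ≤ t ^ (-(d : ℝ) / 2) := by
  unfold heatKernel
  have h1 : Real.exp (-‖x‖ ^ 2 / (4 * t)) ≤ 1 := by
    rw [Real.exp_le_one_iff, neg_div]
    have : 0 ≤ ‖x‖ ^ 2 / (4 * t) := by positivity
    linarith
  have h2 : (4 * Real.pi * t) ^ (-(d : ℝ) / 2) ≤ t ^ (-(d : ℝ) / 2) := by
    apply Real.rpow_le_rpow_of_nonpos ht
    · nlinarith [Real.pi_gt_three]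
    · have : (0 : ℝ) ≤ d := by positivity
      linarith
  calc _ ≤ t ^ (-(d : ℝ) / 2) * 1 := by gcongr
    _ = _ := mul_one _

theorem measurable_heatKernel (d : ℕ) :
    Measurable fun q : ℝ × Ed d => heatKernel d q.1 q.2 := by
  unfold heatKernel
  fun_prop

theorem continuous_heatKernel (d : ℕ) (t : ℝ) : Continuous (heatKernel d t) := by
  unfold heatKernel
  fun_prop

theorem lintegral_heatKernel {d : ℕ} {t : ℝ} (ht : 0 < t) :
    ∫⁻ x, ENNReal.ofReal (heatKernel d t x) = 1 := by
  have h := GaussianFourier.integral_rexp_neg_mul_sq_norm (V := Ed d) (b := 1 / (4 * t))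
    (by positivity)
  have hI : ∫ x, heatKernel d t x = 1 := by
    unfold heatKernel
    rw [integral_const_mul]
    have e : ∀ x : Ed d, Real.exp (-‖x‖ ^ 2 / (4 * t)) = Real.exp (-(1 / (4 * t)) * ‖x‖ ^ 2) := by
      intro x; congr 1; ring
    simp only [e, h]
    rw [finrank_euclideanSpace_fin]
    have e2 : Real.pi / (1 / (4 * t)) = 4 * Real.pi * t := by field_simp
    rw [e2, ← Real.rpow_add (by positivity)]
    rw [show -(d : ℝ) / 2 + d / 2 = 0 by ring, Real.rpow_zero]
  have hint : Integrable (heatKernel d t) := by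
    by_contra hc
    rw [integral_undef hc] at hI
    norm_num at hI
  rw [← ofReal_integral_eq_lintegral_ofReal hint
    (Eventually.of_forall fun x => (heatKernel_pos ht x).le), hI, ENNReal.ofReal_one]

theorem norm_mul_heatKernel_le {d : ℕ} {t : ℝ} (ht : 0 < t) (x : Ed d) :
    ‖x‖ / (2 * t) * heatKernel d t x ≤
      2 ^ ((d : ℝ) / 2) * t ^ (-(1 : ℝ) / 2) * heatKernel d (2 * t) x := by
  unfold heatKernel
  have e1 : (4 * Real.pi * (2 * t)) ^ (-(d : ℝ) / 2)
      = 2 ^ (-(d : ℝ) / 2) * (4 * Real.pi * t) ^ (-(d : ℝ) / 2) := by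
    rw [← Real.mul_rpow (by norm_num) (by positivity)]
    congr 1; ring
  have e2 : (2 : ℝ) ^ ((d : ℝ) / 2) * 2 ^ (-(d : ℝ) / 2) = 1 := by
    rw [← Real.rpow_add (by norm_num), show (d : ℝ) / 2 + -(d : ℝ) / 2 = 0 by ring, Real.rpow_zero]
  have e3 : Real.exp (-‖x‖ ^ 2 / (4 * t))
      = Real.exp (-‖x‖ ^ 2 / (4 * (2 * t))) * Real.exp (-‖x‖ ^ 2 / (4 * (2 * t))) := by
    rw [← Real.exp_add]; congr 1; field_simp; ring
  have e4 : t ^ (-(1 : ℝ) / 2) = (√t)⁻¹ := by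
    rw [Real.sqrt_eq_rpow, ← Real.rpow_neg ht.le]; congr 1; ring
  have hs : 0 < √t := Real.sqrt_pos.2 ht
  have hst : √t * √t = t := Real.mul_self_sqrt ht.le
  have key : ‖x‖ / (2 * t) * Real.exp (-‖x‖ ^ 2 / (4 * (2 * t))) ≤ (√t)⁻¹ := by
    have h1 := Real.add_one_le_exp (‖x‖ ^ 2 / (4 * (2 * t)))
    have h2 : ‖x‖ / (2 * t) ≤ (√t)⁻¹ * (‖x‖ ^ 2 / (4 * (2 * t)) + 1) := by
      set s := √t with hsdef
      rw [← hst]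
      rw [← sub_nonneg]
      have : s⁻¹ * (‖x‖ ^ 2 / (4 * (2 * (s * s))) + 1) - ‖x‖ / (2 * (s * s))
          = ((‖x‖ - 2 * s) ^ 2 + 4 * s ^ 2) / (8 * s ^ 3) := by
        field_simp; ring
      rw [this]; positivity
    rw [neg_div, Real.exp_neg, ← div_eq_mul_inv, div_le_iff₀ (Real.exp_pos _)]
    refine h2.trans ?_
    gcongr
  rw [e1, e3, e4]
  calc _ = ‖x‖ / (2 * t) * Real.exp (-‖x‖ ^ 2 / (4 * (2 * t))) *
        ((4 * Real.pi * t) ^ (-(d : ℝ) / 2) * Real.exp (-‖x‖ ^ 2 / (4 * (2 * t)))) := by ring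
    _ ≤ (√t)⁻¹ *
        ((4 * Real.pi * t) ^ (-(d : ℝ) / 2) * Real.exp (-‖x‖ ^ 2 / (4 * (2 * t)))) := by gcongr
    _ = (2 ^ ((d : ℝ) / 2) * 2 ^ (-(d : ℝ) / 2)) * ((√t)⁻¹ *
        ((4 * Real.pi * t) ^ (-(d : ℝ) / 2) * Real.exp (-‖x‖ ^ 2 / (4 * (2 * t))))) := by
        rw [e2, one_mul]
    _ = _ := by ring

theorem hasFDerivAt_heatKernel {d : ℕ} {t : ℝ} (ht : 0 < t) (x : Ed d) :
    HasFDerivAt (heatKernel d t) (-(heatKernel d t x / (2 * t)) • innerSL ℝ x) x := by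
  unfold heatKernel
  have h1 : HasFDerivAt (fun x : Ed d => ‖x‖ ^ 2) (2 • innerSL ℝ x) x := by
    simpa using (hasStrictFDerivAt_norm_sq x).hasFDerivAt
  have h2 := ((h1.fun_neg.mul_const (4 * t)⁻¹).exp).const_mul ((4 * Real.pi * t) ^ (-(d : ℝ) / 2))
  simp only [← div_eq_mul_inv] at h2
  refine h2.congr_fderiv ?_
  ext y
  simp
  field_simp
  ring

theorem hasDerivAt_heatKernel_line {d : ℕ} {t : ℝ} (ht : 0 < t) (z v : Ed d) (r : ℝ) :
    HasDerivAt (fun r : ℝ => heatKernel d t (z + r • v))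
      (-(heatKernel d t (z + r • v) / (2 * t)) * inner ℝ (z + r • v) v) r := by
  have h1 : HasDerivAt (fun r : ℝ => z + r • v) v r := by
    simpa using ((hasDerivAt_id r).smul_const v).const_add z
  have := (hasFDerivAt_heatKernel ht (z + r • v)).comp_hasDerivAt r h1
  refine this.congr_deriv ?_
  simp only [_root_.smul_apply, innerSL_apply_apply, smul_eq_mul]

/-- A majorant of the difference quotient of the heat kernel in the direction `v`. -/
def gradKernel (d : ℕ) (t : ℝ) (v z : Ed d) : ℝ≥0∞ :=
  ENNReal.ofReal (2 ^ ((d : ℝ) / 2) * t ^ (-(1 : ℝ) / 2)) *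
    ∫⁻ r in Set.Ioc (0 : ℝ) 1, ENNReal.ofReal (heatKernel d (2 * t) (z + r • v))

theorem measurable_gradKernel (d : ℕ) (v : Ed d) :
    Measurable fun q : ℝ × Ed d => gradKernel d q.1 v q.2 := by
  unfold gradKernel
  refine Measurable.mul (by fun_prop) ?_
  have h : Measurable fun w : (ℝ × Ed d) × ℝ =>
      ENNReal.ofReal (heatKernel d (2 * w.1.1) (w.1.2 + w.2 • v)) := by
    refine ENNReal.measurable_ofReal.comp ((measurable_heatKernel d).comp
      (g := heatKernel d |>.uncurry) (f := fun w : (ℝ × Ed d) × ℝ => (2 * w.1.1, w.1.2 + w.2 • v)) ?_)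
    fun_prop
  exact h.lintegral_prod_right'

theorem enorm_heatKernel_sub_le {d : ℕ} {t : ℝ} (ht : 0 < t) (v z : Ed d) :
    ‖heatKernel d t (z + v) - heatKernel d t z‖ₑ ≤ ‖v‖ₑ * gradKernel d t v z := by
  have hc : Continuous fun r : ℝ =>
      -(heatKernel d t (z + r • v) / (2 * t)) * inner ℝ (z + r • v) v := by
    have := continuous_heatKernel d t
    fun_prop
  have hf := intervalIntegral.integral_eq_sub_of_hasDerivAt (a := 0) (b := 1)
    (fun r _ => hasDerivAt_heatKernel_line ht z v r) (hc.intervalIntegrable _ _)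
  simp only [one_smul, zero_smul, add_zero] at hf
  rw [← hf, intervalIntegral.integral_of_le zero_le_one]
  refine (enorm_integral_le_lintegral_enorm _).trans ?_
  have hm : Measurable fun r : ℝ => ENNReal.ofReal (heatKernel d (2 * t) (z + r • v)) := by
    have := continuous_heatKernel d (2 * t)
    fun_prop
  unfold gradKernel
  rw [← mul_assoc, ← lintegral_const_mul _ hm]
  refine lintegral_mono fun r => ?_
  rw [← ofReal_norm v, ← ENNReal.ofReal_mul (norm_nonneg _),
    ← ENNReal.ofReal_mul (by positivity), ← ofReal_norm]
  apply ENNReal.ofReal_le_ofReal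
  have hp := heatKernel_pos ht (z + r • v)
  rw [norm_mul, norm_neg, Real.norm_of_nonneg (by positivity)]
  calc _ ≤ heatKernel d t (z + r • v) / (2 * t) * (‖z + r • v‖ * ‖v‖) := by
        gcongr; exact norm_inner_le_norm _ _
    _ = ‖v‖ * (‖z + r • v‖ / (2 * t) * heatKernel d t (z + r • v)) := by ring
    _ ≤ ‖v‖ * (2 ^ ((d : ℝ) / 2) * t ^ (-(1 : ℝ) / 2) * heatKernel d (2 * t) (z + r • v)) := by
        exact mul_le_mul_of_nonneg_left (norm_mul_heatKernel_le ht _) (norm_nonneg _)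
    _ = _ := by ring

theorem lintegral_gradKernel {d : ℕ} {t : ℝ} (ht : 0 < t) (v : Ed d) :
    ∫⁻ z, gradKernel d t v z = ENNReal.ofReal (2 ^ ((d : ℝ) / 2) * t ^ (-(1 : ℝ) / 2)) := by
  unfold gradKernel
  have hm : Measurable fun w : Ed d × ℝ =>
      ENNReal.ofReal (heatKernel d (2 * t) (w.1 + w.2 • v)) := by
    have := continuous_heatKernel d (2 * t)
    fun_prop
  rw [lintegral_const_mul _ hm.lintegral_prod_right', lintegral_lintegral_swap hm.aemeasurable]
  have : ∀ r : ℝ, ∫⁻ z, ENNReal.ofReal (heatKernel d (2 * t) (z + r • v)) = 1 := by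
    intro r
    rw [lintegral_add_right_eq_self (fun z => ENNReal.ofReal (heatKernel d (2 * t) z))]
    exact lintegral_heatKernel (by positivity)
  simp [this]

theorem gradKernel_le {d : ℕ} {t : ℝ} (ht : 0 < t) (v z : Ed d) :
    gradKernel d t v z ≤ ENNReal.ofReal (2 ^ ((d : ℝ) / 2) * t ^ (-(1 : ℝ) / 2)) *
      ENNReal.ofReal (t ^ (-(d : ℝ) / 2)) := by
  unfold gradKernel
  gcongr
  calc _ ≤ ∫⁻ r in Set.Ioc (0 : ℝ) 1, ENNReal.ofReal (t ^ (-(d : ℝ) / 2)) := by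
        refine lintegral_mono fun r => ENNReal.ofReal_le_ofReal ?_
        refine (heatKernel_le (by positivity) _).trans ?_
        apply Real.rpow_le_rpow_of_nonpos ht (by linarith)
        have : (0 : ℝ) ≤ d := by positivity
        linarith
    _ = _ := by simp

theorem heatKernel_le_mul {d : ℕ} {s t : ℝ} (hs : 0 < s) (hst : 2 * s ≤ t) (x z y : Ed d) :
    heatKernel d s (z - y) ≤ (4 * Real.pi * s) ^ (-(d : ℝ) / 2) *
      ((4 * Real.pi * t) ^ (-(d : ℝ) / 2))⁻¹ * Real.exp (‖x - z‖ ^ 2 / (4 * s)) *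
        heatKernel d t (x - y) := by
  have ht : 0 < t := by linarith
  unfold heatKernel
  have hpos : 0 < (4 * Real.pi * t) ^ (-(d : ℝ) / 2) := by positivity
  have h1 : ‖x - y‖ ^ 2 ≤ 2 * ‖x - z‖ ^ 2 + 2 * ‖z - y‖ ^ 2 := by
    have := norm_add_le (x - z) (z - y)
    rw [sub_add_sub_cancel] at this
    nlinarith [sq_nonneg (‖x - z‖ - ‖z - y‖), norm_nonneg (x - y), norm_nonneg (x - z),
      norm_nonneg (z - y)]
  have h2 : -‖z - y‖ ^ 2 / (4 * s) ≤ ‖x - z‖ ^ 2 / (4 * s) + -‖x - y‖ ^ 2 / (4 * t) := by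
    have h3 : ‖x - y‖ ^ 2 / (4 * t) ≤ ‖x - y‖ ^ 2 / (8 * s)  :=
      div_le_div_of_nonneg_left (by positivity) (by positivity) (by linarith)
    have h4 : ‖x - y‖ ^ 2 / (8 * s) ≤ (2 * ‖x - z‖ ^ 2 + 2 * ‖z - y‖ ^ 2) / (8 * s) := by gcongr
    have h5 : (2 * ‖x - z‖ ^ 2 + 2 * ‖z - y‖ ^ 2) / (8 * s)
        = ‖x - z‖ ^ 2 / (4 * s) + ‖z - y‖ ^ 2 / (4 * s) := by field_simp; ring
    rw [neg_div, neg_div]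
    linarith
  calc _ ≤ (4 * Real.pi * s) ^ (-(d : ℝ) / 2) *
        Real.exp (‖x - z‖ ^ 2 / (4 * s) + -‖x - y‖ ^ 2 / (4 * t)) := by gcongr
    _ = _ := by rw [Real.exp_add]; field_simp

theorem heatKernel_convexComb_le {d : ℕ} {t : ℝ} (ht : 0 < t) (x x' y : Ed d) {a b : ℝ}
    (ha : 0 ≤ a) (hb : 0 ≤ b) (hab : a + b = 1) :
    heatKernel d t (a • x + b • x' - y) ≤ Real.exp (‖x - x'‖ ^ 2 / (4 * t)) *
      (heatKernel d t (x - y) + heatKernel d t (x' - y)) := by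
  have e : ‖a • x + b • x' - y‖ ^ 2
      = a * ‖x - y‖ ^ 2 + b * ‖x' - y‖ ^ 2 - a * b * ‖x - x'‖ ^ 2 := by
    obtain rfl : b = 1 - a := by linarith
    have e1 : a • x + (1 - a) • x' - y = a • (x - y) + (1 - a) • (x' - y) := by module
    have e2 : x - x' = (x - y) - (x' - y) := by abel
    rw [e1, e2]
    generalize x - y = v
    generalize x' - y = w
    rw [norm_add_sq_real, norm_sub_sq_real, norm_smul, norm_smul, real_inner_smul_left,
      real_inner_smul_right, mul_pow, mul_pow, Real.norm_eq_abs, Real.norm_eq_abs, sq_abs, sq_abs]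
    ring
  have hab1 : a * b ≤ 1 := by nlinarith
  have hab0 : 0 ≤ a * b := by positivity
  have hmin : min (‖x - y‖ ^ 2) (‖x' - y‖ ^ 2) - ‖x - x'‖ ^ 2 ≤ ‖a • x + b • x' - y‖ ^ 2 := by
    rw [e]
    set m := min (‖x - y‖ ^ 2) (‖x' - y‖ ^ 2)
    have h1 : m ≤ ‖x - y‖ ^ 2 := min_le_left _ _
    have h2 : m ≤ ‖x' - y‖ ^ 2 := min_le_right _ _
    have h3 : m = a * m + b * m := by rw [← add_mul, hab, one_mul]
    have h4 := mul_le_mul_of_nonneg_left h1 ha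
    have h5 := mul_le_mul_of_nonneg_left h2 hb
    have h6 := mul_le_mul_of_nonneg_right hab1 (sq_nonneg ‖x - x'‖)
    linarith
  have aux : ∀ w : Ed d, ‖w‖ ^ 2 - ‖x - x'‖ ^ 2 ≤ ‖a • x + b • x' - y‖ ^ 2 →
      heatKernel d t (a • x + b • x' - y) ≤
        Real.exp (‖x - x'‖ ^ 2 / (4 * t)) * heatKernel d t w := by
    intro w hw
    unfold heatKernel
    rw [mul_left_comm, ← Real.exp_add, ← add_div]
    gcongr
    linarith
  have p1 := heatKernel_pos ht (x - y)
  have p2 := heatKernel_pos ht (x' - y)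
  rcases min_choice (‖x - y‖ ^ 2) (‖x' - y‖ ^ 2) with h | h <;> rw [h] at hmin <;>
    refine (aux _ hmin).trans ?_ <;> gcongr <;> linarith

/-- The semigroup property of the heat kernel, for equal times. -/
theorem lintegral_heatKernel_mul {d : ℕ} {t : ℝ} (ht : 0 < t) (x y : Ed d) :
    ∫⁻ z, ENNReal.ofReal (heatKernel d t (x - z)) * ENNReal.ofReal (heatKernel d t (z - y)) =
      ENNReal.ofReal (heatKernel d (2 * t) (x - y)) := by
  have e : ∀ z, ENNReal.ofReal (heatKernel d t (x - z)) * ENNReal.ofReal (heatKernel d t (z - y))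
      = ENNReal.ofReal (heatKernel d (2 * t) (x - y)) *
        ENNReal.ofReal (heatKernel d (t / 2) (z - (1 / 2 : ℝ) • (x + y))) := by
    intro z
    rw [← ENNReal.ofReal_mul (heatKernel_pos ht _).le,
      ← ENNReal.ofReal_mul (heatKernel_pos (by positivity) _).le]
    congr 1
    unfold heatKernel
    have e1 : (4 * Real.pi * t) ^ (-(d : ℝ) / 2) * (4 * Real.pi * t) ^ (-(d : ℝ) / 2)
        = (4 * Real.pi * (2 * t)) ^ (-(d : ℝ) / 2) * (4 * Real.pi * (t / 2)) ^ (-(d : ℝ) / 2) := by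
      rw [← Real.mul_rpow (by positivity) (by positivity),
        ← Real.mul_rpow (by positivity) (by positivity)]
      congr 1; ring
    have e2 : ‖x - z‖ ^ 2 + ‖z - y‖ ^ 2
        = ‖x - y‖ ^ 2 / 2 + 2 * ‖z - (1 / 2 : ℝ) • (x + y)‖ ^ 2 := by
      have a1 : x - y = (x - z) + (z - y) := by abel
      have a2 : z - (1 / 2 : ℝ) • (x + y) = (1 / 2 : ℝ) • ((z - y) - (x - z)) := by module
      rw [a2, norm_smul, mul_pow, a1]
      generalize x - z = v
      generalize z - y = w
      rw [norm_add_sq_real, norm_sub_sq_real, real_inner_comm]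
      norm_num
      ring
    rw [mul_mul_mul_comm, e1, ← Real.exp_add]
    symm
    rw [mul_mul_mul_comm, ← Real.exp_add]
    congr 2
    field_simp
    linarith
  simp only [e]
  have hm : Measurable fun z => ENNReal.ofReal (heatKernel d (t / 2) (z - (1 / 2 : ℝ) • (x + y))) := by
    have := continuous_heatKernel d (t / 2)
    fun_prop
  rw [lintegral_const_mul _ hm,
    lintegral_sub_right_eq_self (fun z => ENNReal.ofReal (heatKernel d (t / 2) z)),
    lintegral_heatKernel (by positivity), mul_one]

theorem lintegral_Ioo_rpow_neg {β t : ℝ} (hβ : β < 1) (ht : 0 < t) :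
    ∫⁻ s in Set.Ioo 0 t, ENNReal.ofReal (s ^ (-β)) = ENNReal.ofReal (t ^ (1 - β) / (1 - β)) := by
  have hi : IntervalIntegrable (fun s : ℝ => s ^ (-β)) volume 0 t :=
    intervalIntegral.intervalIntegrable_rpow' (by linarith)
  have hv := integral_rpow (a := 0) (b := t) (r := -β) (Or.inl (by linarith))
  rw [Real.zero_rpow (by linarith), sub_zero, show -β + 1 = 1 - β by ring,
    intervalIntegral.integral_of_le ht.le] at hv
  rw [← restrict_Ioo_eq_restrict_Ioc] at hv
  rw [intervalIntegrable_iff_integrableOn_Ioo_of_le ht.le] at hi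
  rw [← hv, ofReal_integral_eq_lintegral_ofReal hi]
  filter_upwards [ae_restrict_mem measurableSet_Ioo] with s hs
  exact Real.rpow_nonneg hs.1.le _

theorem lintegral_Ioo_comp_sub_left (t : ℝ) (g : ℝ → ℝ≥0∞) :
    ∫⁻ s in Set.Ioo 0 t, g (t - s) = ∫⁻ s in Set.Ioo 0 t, g s := by
  rw [← lintegral_indicator measurableSet_Ioo, ← lintegral_indicator measurableSet_Ioo,
    ← lintegral_sub_left_eq_self _ t]
  congr 1
  ext s
  simp only [Set.indicator, Set.mem_Ioo, sub_sub_cancel]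
  congr 1
  apply propext
  constructor <;> rintro ⟨h1, h2⟩ <;> constructor <;> linarith

theorem lintegral_Ioo_rpow_mul_rpow_le {α β t : ℝ} (hα : α < 1) (hα0 : 0 ≤ α) (hβ : β < 1)
    (hβ0 : 0 ≤ β) (ht : 0 < t) :
    ∫⁻ s in Set.Ioo 0 t, ENNReal.ofReal ((t - s) ^ (-α) * s ^ (-β)) ≤
      ENNReal.ofReal ((2 ^ α / (1 - β) + 2 ^ β / (1 - α)) * t ^ (1 - α - β)) := by
  have hpt : ∀ s ∈ Set.Ioo 0 t, ENNReal.ofReal ((t - s) ^ (-α) * s ^ (-β)) ≤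
      ENNReal.ofReal ((t / 2) ^ (-α)) * ENNReal.ofReal (s ^ (-β)) +
        ENNReal.ofReal ((t / 2) ^ (-β)) * ENNReal.ofReal ((t - s) ^ (-α)) := by
    rintro s ⟨hs0, hst⟩
    have hts : 0 < t - s := by linarith
    rw [← ENNReal.ofReal_mul (by positivity), ← ENNReal.ofReal_mul (by positivity),
      ← ENNReal.ofReal_add (by positivity) (by positivity)]
    apply ENNReal.ofReal_le_ofReal
    have p1 : 0 < s ^ (-β) := by positivity
    have p2 : 0 < (t - s) ^ (-α) := by positivity
    have p3 : 0 < (t / 2) ^ (-α) := by positivity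
    have p4 : 0 < (t / 2) ^ (-β) := by positivity
    rcases le_total s (t / 2) with h | h
    · have : (t - s) ^ (-α) ≤ (t / 2) ^ (-α) :=
        Real.rpow_le_rpow_of_nonpos (by positivity) (by linarith) (by linarith)
      nlinarith
    · have : s ^ (-β) ≤ (t / 2) ^ (-β) :=
        Real.rpow_le_rpow_of_nonpos (by positivity) (by linarith) (by linarith)
      nlinarith
  have hm : Measurable fun s : ℝ => ENNReal.ofReal (s ^ (-β)) := by fun_prop
  have hm' : Measurable fun s : ℝ => ENNReal.ofReal ((t - s) ^ (-α)) := by fun_prop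
  calc _ ≤ ∫⁻ s in Set.Ioo 0 t, (ENNReal.ofReal ((t / 2) ^ (-α)) * ENNReal.ofReal (s ^ (-β)) +
        ENNReal.ofReal ((t / 2) ^ (-β)) * ENNReal.ofReal ((t - s) ^ (-α))) :=
        setLIntegral_mono' measurableSet_Ioo hpt
    _ = ENNReal.ofReal ((t / 2) ^ (-α)) * ENNReal.ofReal (t ^ (1 - β) / (1 - β)) +
        ENNReal.ofReal ((t / 2) ^ (-β)) * ENNReal.ofReal (t ^ (1 - α) / (1 - α)) := by
        rw [lintegral_add_left (hm.const_mul _), lintegral_const_mul _ hm,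
          lintegral_const_mul _ hm', lintegral_Ioo_rpow_neg hβ ht,
          lintegral_Ioo_comp_sub_left t fun s => ENNReal.ofReal (s ^ (-α)),
          lintegral_Ioo_rpow_neg hα ht]
    _ = _ := by
        have q1 : 0 < 1 - α := by linarith
        have q2 : 0 < 1 - β := by linarith
        rw [← ENNReal.ofReal_mul (by positivity), ← ENNReal.ofReal_mul (by positivity),
          ← ENNReal.ofReal_add (by positivity) (by positivity)]
        congr 1
        have h2 : ∀ γ : ℝ, (t / 2) ^ (-γ) = 2 ^ γ * t ^ (-γ) := by
          intro γ
          rw [Real.div_rpow ht.le (by norm_num), Real.rpow_neg (by norm_num : (0 : ℝ) ≤ 2)]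
          field_simp
        have e1 : t ^ (-α) * t ^ (1 - β) = t ^ (1 - α - β) := by
          rw [← Real.rpow_add ht]; congr 1; ring
        have e2 : t ^ (-β) * t ^ (1 - α) = t ^ (1 - α - β) := by
          rw [← Real.rpow_add ht]; congr 1; ring
        rw [h2, h2]
        calc _ = 2 ^ α / (1 - β) * (t ^ (-α) * t ^ (1 - β)) +
              2 ^ β / (1 - α) * (t ^ (-β) * t ^ (1 - α)) := by ring
          _ = _ := by rw [e1, e2]; ring

theorem enorm_heatConv_sub_le {d m : ℕ} {t : ℝ} (ht : 0 < t) {f : Ed d → Ed m} {x v : Ed d}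
    (hx : Integrable fun y => heatKernel d t (x - y) • f y)
    (hv : Integrable fun y => heatKernel d t (x + v - y) • f y) :
    ‖heatConv d t f (x + v) - heatConv d t f x‖ₑ ≤
      ∫⁻ y, ‖v‖ₑ * (gradKernel d t v (x - y) * ‖f y‖ₑ) := by
  unfold heatConv
  rw [← integral_sub hv hx]
  refine (enorm_integral_le_lintegral_enorm _).trans (lintegral_mono fun y => ?_)
  simp only
  rw [← sub_smul, enorm_smul, ← mul_assoc]
  gcongr
  have := enorm_heatKernel_sub_le ht v (x - y)
  rwa [show x - y + v = x + v - y by abel] at this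

theorem eLpNorm_fderiv_le {d m : ℕ} {N : Ed d → Ed m} (hN : StronglyMeasurable N) {q : ℝ}
    (hq : 1 ≤ q) {L : ℝ≥0∞}
    (h : ∀ v : Ed d, ∃ Q : Ed d → ℝ≥0∞, (∀ x, ‖N (x + v) - N x‖ₑ ≤ ‖v‖ₑ * Q x) ∧
      ∫⁻ x, Q x ^ q ≤ L ^ q) :
    eLpNorm (fderiv ℝ N) (ENNReal.ofReal q) volume ≤ d * L := by
  have hq0 : 0 < q := by linarith
  have hS : MeasurableSet {x | DifferentiableAt ℝ N x} := measurableSet_of_differentiableAt ℝ N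
  set S := {x | DifferentiableAt ℝ N x}
  let e : Fin d → Ed d := fun i => EuclideanSpace.single i 1
  have key : ∀ i, eLpNorm (fun x => fderiv ℝ N x (e i)) (ENNReal.ofReal q) volume ≤ L := by
    intro i
    let δ : ℕ → ℝ := fun n => 1 / ((n : ℝ) + 1)
    have hδ : ∀ n, 0 < δ n := fun n => by positivity
    let F : ℕ → Ed d → Ed m := fun n =>
      S.indicator fun x => (δ n)⁻¹ • (N (x + δ n • e i) - N x)
    have hF : ∀ n, AEStronglyMeasurable (F n) volume := by
      intro n
      have : StronglyMeasurable fun x => N (x + δ n • e i) :=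
        hN.comp_measurable (measurable_id.add_const _)
      exact (((this.sub hN).const_smul (δ n)⁻¹).indicator hS).aestronglyMeasurable
    have hlim : ∀ᵐ x ∂(volume : Measure (Ed d)),
        Tendsto (fun n => F n x) atTop (nhds (fderiv ℝ N x (e i))) := by
      refine Eventually.of_forall fun x => ?_
      by_cases hx : x ∈ S
      · have h1 := (show DifferentiableAt ℝ N x from hx).hasFDerivAt.lim_real (e i)
        have h2 : Tendsto (fun n : ℕ => (n : ℝ) + 1) atTop atTop :=
          tendsto_atTop_add_const_right _ _ tendsto_natCast_atTop_atTop
        refine (h1.comp h2).congr fun n => ?_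
        simp [F, hx, δ]
      · have h1 : fderiv ℝ N x = 0 := fderiv_zero_of_not_differentiableAt hx
        simp [F, hx, h1]
    refine (Lp.eLpNorm_lim_le_liminf_eLpNorm hF _ hlim).trans ?_
    refine liminf_le_of_le (by isBoundedDefault) fun b hb => ?_
    obtain ⟨n, hn⟩ := hb.exists
    refine hn.trans ?_
    obtain ⟨Q, hQ1, hQ2⟩ := h (δ n • e i)
    rw [eLpNorm_eq_lintegral_rpow_enorm_toReal (by simpa using hq0) ENNReal.ofReal_ne_top,
      ENNReal.toReal_ofReal hq0.le]
    rw [one_div, ENNReal.rpow_inv_le_iff hq0]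
    refine le_trans (lintegral_mono fun x => ?_) hQ2
    gcongr
    by_cases hx : x ∈ S
    · simp only [F, Set.indicator_of_mem hx]
      rw [enorm_smul]
      have hnorm : ‖δ n • e i‖ₑ = ‖δ n‖ₑ := by
        rw [enorm_smul]; simp [e, enorm_eq_nnnorm]
      calc _ ≤ ‖(δ n)⁻¹‖ₑ * (‖δ n‖ₑ * Q x) := by
            gcongr; rw [← hnorm]; exact hQ1 x
        _ = ‖(δ n)⁻¹ * δ n‖ₑ * Q x := by rw [enorm_mul, mul_assoc]
        _ = Q x := by rw [inv_mul_cancel₀ (hδ n).ne']; simp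
    · simp [F, hx]
  have hle : ∀ x, ‖fderiv ℝ N x‖ ≤ ∑ i, ‖fderiv ℝ N x (e i)‖ := by
    intro x
    refine ContinuousLinearMap.opNorm_le_bound _ (by positivity) fun y => ?_
    have hy : y = ∑ i, y i • e i := by
      simpa [e] using ((EuclideanSpace.basisFun (Fin d) ℝ).sum_repr y).symm
    conv_lhs => rw [hy, map_sum]
    refine (norm_sum_le _ _).trans ?_
    rw [Finset.sum_mul]
    refine Finset.sum_le_sum fun i _ => ?_
    rw [map_smul, norm_smul, mul_comm]
    gcongr
    exact PiLp.norm_apply_le y i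
  have hmeas : ∀ i, Measurable fun x => fderiv ℝ N x (e i) :=
    fun i => measurable_fderiv_apply_const ℝ N (e i)
  calc _ ≤ eLpNorm (∑ i, fun x => ‖fderiv ℝ N x (e i)‖) (ENNReal.ofReal q) volume := by
        refine eLpNorm_mono_real fun x => ?_
        simpa using hle x
    _ ≤ ∑ i, eLpNorm (fun x => ‖fderiv ℝ N x (e i)‖) (ENNReal.ofReal q) volume :=
        eLpNorm_sum_le (fun i _ => (hmeas i).norm.aestronglyMeasurable) (by simpa using hq)
    _ ≤ ∑ _i : Fin d, L := by
        refine Finset.sum_le_sum fun i _ => ?_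
        rw [eLpNorm_norm]
        exact key i
    _ = _ := by simp

theorem measurable_ofReal_heatKernel (d : ℕ) (t : ℝ) :
    Measurable fun z : Ed d => ENNReal.ofReal (heatKernel d t z) :=
  (continuous_heatKernel d t).measurable.ennreal_ofReal

theorem lintegral_heatKernel_mul_le {d : ℕ} {a t m : ℝ} (ha : 1 ≤ a) (ht : 0 < t) (hm : 0 ≤ m)
    {g : Ed d → ℝ≥0∞} (hg : AEMeasurable g volume) (h : ∫⁻ y, g y ^ a ≤ ENNReal.ofReal m ^ a)
    (x : Ed d) :
    ∫⁻ y, ENNReal.ofReal (heatKernel d t (x - y)) * g y ≤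
      ENNReal.ofReal (m * t ^ (-((d : ℝ) / (2 * a)))) := by
  refine (lintegral_conv_le (c := 1) (κ := ENNReal.ofReal (t ^ (-(d : ℝ) / 2))) ha
    (measurable_ofReal_heatKernel d t) hg (lintegral_heatKernel ht).le (fun x => ?_) h x).trans
    (le_of_eq ?_)
  · rw [one_mul]; exact ENNReal.ofReal_le_ofReal (heatKernel_le ht x)
  · rw [one_mul, ENNReal.ofReal_rpow_of_nonneg (by positivity) (by positivity),
      ← ENNReal.ofReal_mul hm, ← Real.rpow_mul ht.le]
    congr 3
    field_simp

theorem integrable_heatKernel_smul {d m : ℕ} {t : ℝ} (ht : 0 < t) {f : Ed d → Ed m}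
    (hf : AEStronglyMeasurable f volume) {x : Ed d}
    (h : ∫⁻ y, ENNReal.ofReal (heatKernel d t (x - y)) * ‖f y‖ₑ < ∞) :
    Integrable fun y => heatKernel d t (x - y) • f y := by
  refine ⟨?_, ?_⟩
  · exact ((continuous_heatKernel d t).comp (continuous_const.sub continuous_id)).aestronglyMeasurable.smul hf
  · refine lt_of_le_of_lt (lintegral_mono fun y => ?_) h
    simp only
    rw [enorm_smul, Real.enorm_of_nonneg (heatKernel_pos ht _).le]

theorem enorm_heatConv_le {d m : ℕ} {t : ℝ} (ht : 0 < t) (f : Ed d → Ed m) (x : Ed d) :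
    ‖heatConv d t f x‖ₑ ≤ ∫⁻ y, ENNReal.ofReal (heatKernel d t (x - y)) * ‖f y‖ₑ := by
  unfold heatConv
  refine (enorm_integral_le_lintegral_enorm _).trans (lintegral_mono fun y => ?_)
  simp only
  rw [enorm_smul, Real.enorm_of_nonneg (heatKernel_pos ht _).le]

theorem stronglyMeasurable_heatConv {d m : ℕ} (t : ℝ) {f : ℝ → Ed d → Ed m}
    (hf : Measurable (Function.uncurry f)) :
    StronglyMeasurable fun q : ℝ × Ed d => heatConv d (t - q.1) (f q.1) q.2 := by
  unfold heatConv
  refine StronglyMeasurable.integral_prod_right'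
    (f := fun w : (ℝ × Ed d) × Ed d => heatKernel d (t - w.1.1) (w.1.2 - w.2) • f w.1.1 w.2) ?_
  apply Measurable.stronglyMeasurable
  have h1 : Measurable fun w : (ℝ × Ed d) × Ed d => heatKernel d (t - w.1.1) (w.1.2 - w.2) :=
    (measurable_heatKernel d).comp
      (f := fun w : (ℝ × Ed d) × Ed d => (t - w.1.1, w.1.2 - w.2)) (by fun_prop)
  have h2 : Measurable fun w : (ℝ × Ed d) × Ed d => f w.1.1 w.2 :=
    hf.comp (f := fun w : (ℝ × Ed d) × Ed d => (w.1.1, w.2)) (by fun_prop)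
  exact h1.smul h2

/-- The Duhamel term of the mild formulation. -/
def duhamel (d m : ℕ) (f : ℝ → Ed d → Ed m) (t : ℝ) (x : Ed d) : Ed m :=
  ∫ s in Set.Ioo (0 : ℝ) t, heatConv d (t - s) (f s) x

theorem stronglyMeasurable_duhamel {d m : ℕ} {f : ℝ → Ed d → Ed m}
    (hf : Measurable (Function.uncurry f)) (t : ℝ) : StronglyMeasurable (duhamel d m f t) :=
  (stronglyMeasurable_heatConv t hf).integral_prod_left'

/-- The forcing is controlled in `L^a`, with a singularity `s^{-β}` at the initial time. -/
def ForcingBound (d m : ℕ) (f : ℝ → Ed d → Ed m) (a β M t : ℝ) : Prop :=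
  ∀ s ∈ Set.Ioo 0 t, ∫⁻ y, ‖f s y‖ₑ ^ a ≤ ENNReal.ofReal (M * s ^ (-β)) ^ a

theorem integrableOn_heatConv {d m : ℕ} {f : ℝ → Ed d → Ed m}
    (hf : Measurable (Function.uncurry f)) {a β M t : ℝ} (ha : 1 ≤ a) (hβ : β < 1) (hβ0 : 0 ≤ β)
    (hM : 0 ≤ M) (ht : 0 < t) (hda : (d : ℝ) / (2 * a) < 1) (h : ForcingBound d m f a β M t)
    (x : Ed d) :
    IntegrableOn (fun s => heatConv d (t - s) (f s) x) (Set.Ioo 0 t) := by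
  have hfs : ∀ s, Measurable (f s) := fun s => hf.comp (measurable_const.prodMk measurable_id)
  refine ⟨?_, ?_⟩
  · exact ((stronglyMeasurable_heatConv t hf).comp_measurable
      (measurable_id.prodMk measurable_const)).aestronglyMeasurable
  · have h2 := lintegral_Ioo_rpow_mul_rpow_le (α := (d : ℝ) / (2 * a)) hda (by positivity) hβ hβ0 ht
    calc _ ≤ ∫⁻ s in Set.Ioo 0 t, ENNReal.ofReal M *
          ENNReal.ofReal ((t - s) ^ (-((d : ℝ) / (2 * a))) * s ^ (-β)) := by
          refine setLIntegral_mono' measurableSet_Ioo fun s hs => ?_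
          have hts : 0 < t - s := by linarith [hs.2]
          have hs0 := hs.1
          refine (enorm_heatConv_le hts _ _).trans ?_
          refine (lintegral_heatKernel_mul_le ha hts (by positivity)
            (hfs s).enorm.aemeasurable (h s hs) x).trans (le_of_eq ?_)
          rw [← ENNReal.ofReal_mul hM]
          congr 1; ring
      _ < ∞ := by
          rw [lintegral_const_mul _ (by fun_prop)]
          exact ENNReal.mul_lt_top ENNReal.ofReal_lt_top (h2.trans_lt ENNReal.ofReal_lt_top)

/-- A majorant of the difference quotient of the Duhamel term in the direction `v`. -/
def duhamelQuot (d m : ℕ) (f : ℝ → Ed d → Ed m) (t : ℝ) (v x : Ed d) : ℝ≥0∞ :=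
  ∫⁻ s in Set.Ioo (0 : ℝ) t, ∫⁻ y, gradKernel d (t - s) v (x - y) * ‖f s y‖ₑ

theorem measurable_duhamelQuot_integrand {d m : ℕ} {f : ℝ → Ed d → Ed m}
    (hf : Measurable (Function.uncurry f)) (t : ℝ) (v : Ed d) :
    Measurable (Function.uncurry fun (s : ℝ) (x : Ed d) =>
      ∫⁻ y, gradKernel d (t - s) v (x - y) * ‖f s y‖ₑ) := by
  have : Measurable fun w : (ℝ × Ed d) × Ed d =>
      gradKernel d (t - w.1.1) v (w.1.2 - w.2) * ‖f w.1.1 w.2‖ₑ := by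
    refine Measurable.mul ?_ ?_
    · exact (measurable_gradKernel d v).comp
        (f := fun w : (ℝ × Ed d) × Ed d => (t - w.1.1, w.1.2 - w.2)) (by fun_prop)
    · exact (hf.comp (f := fun w : (ℝ × Ed d) × Ed d => (w.1.1, w.2)) (by fun_prop)).enorm
  exact this.lintegral_prod_right'

theorem enorm_duhamel_sub_le {d m : ℕ} {f : ℝ → Ed d → Ed m}
    (hf : Measurable (Function.uncurry f)) {a β M t : ℝ} (ha : 1 ≤ a) (hβ : β < 1) (hβ0 : 0 ≤ β)
    (hM : 0 ≤ M) (ht : 0 < t) (hda : (d : ℝ) / (2 * a) < 1) (h : ForcingBound d m f a β M t)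
    (v x : Ed d) :
    ‖duhamel d m f t (x + v) - duhamel d m f t x‖ₑ ≤ ‖v‖ₑ * duhamelQuot d m f t v x := by
  have hfs : ∀ s, Measurable (f s) := fun s => hf.comp (measurable_const.prodMk measurable_id)
  have hm : Measurable fun s => ∫⁻ y, gradKernel d (t - s) v (x - y) * ‖f s y‖ₑ :=
    (measurable_duhamelQuot_integrand hf t v).comp (f := fun s : ℝ => (s, x)) (by fun_prop)
  have hI := fun z => integrableOn_heatConv hf ha hβ hβ0 hM ht hda h z
  have hsub : duhamel d m f t (x + v) - duhamel d m f t x = ∫ s in Set.Ioo 0 t,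
      (heatConv d (t - s) (f s) (x + v) - heatConv d (t - s) (f s) x) :=
    (integral_sub (hI (x + v)) (hI x)).symm
  have hpt : ∀ s ∈ Set.Ioo 0 t,
      ‖heatConv d (t - s) (f s) (x + v) - heatConv d (t - s) (f s) x‖ₑ ≤
        ‖v‖ₑ * ∫⁻ y, gradKernel d (t - s) v (x - y) * ‖f s y‖ₑ := by
    intro s hs
    have hts : 0 < t - s := by linarith [hs.2]
    have hs0 := hs.1
    have hint : ∀ z, Integrable fun y => heatKernel d (t - s) (z - y) • f s y := by
      intro z
      refine integrable_heatKernel_smul hts (hfs s).aestronglyMeasurable ?_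
      exact (lintegral_heatKernel_mul_le ha hts (by positivity) (hfs s).enorm.aemeasurable
        (h s hs) z).trans_lt ENNReal.ofReal_lt_top
    have hK : Measurable fun y => gradKernel d (t - s) v (x - y) :=
      (measurable_gradKernel d v).comp (f := fun y : Ed d => (t - s, x - y))
        (Measurable.prodMk measurable_const (measurable_const.sub measurable_id))
    have h3 := enorm_heatConv_sub_le hts (hint x) (hint (x + v))
    have hKm : Measurable fun y => gradKernel d (t - s) v (x - y) * ‖f s y‖ₑ :=
      hK.mul (hfs s).enorm
    exact h3.trans (lintegral_const_mul ‖v‖ₑ hKm).le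
  rw [hsub, duhamelQuot, ← lintegral_const_mul _ hm]
  exact (enorm_integral_le_lintegral_enorm _).trans (setLIntegral_mono' measurableSet_Ioo hpt)

/-- The constant in the gradient estimates of the Duhamel term. -/
def duhamelConst (d : ℕ) (α β : ℝ) : ℝ :=
  2 ^ ((d : ℝ) / 2) * (2 ^ α / (1 - β) + 2 ^ β / (1 - α))

theorem duhamelConst_pos {d : ℕ} {α β : ℝ} (hα : α < 1) (hβ : β < 1) : 0 < duhamelConst d α β := by
  unfold duhamelConst
  have h1 : 0 < 1 - α := by linarith
  have h2 : 0 < 1 - β := by linarith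
  positivity

theorem lintegral_duhamel_weight_le {d : ℕ} {α β M t : ℝ} (hα : α < 1) (hα0 : 0 ≤ α) (hβ : β < 1)
    (hβ0 : 0 ≤ β) (hM : 0 ≤ M) (ht : 0 < t) :
    ∫⁻ s in Set.Ioo 0 t, ENNReal.ofReal (2 ^ ((d : ℝ) / 2) * M * ((t - s) ^ (-α) * s ^ (-β))) ≤
      ENNReal.ofReal (duhamelConst d α β * M * t ^ (1 - α - β)) := by
  have h2 := lintegral_Ioo_rpow_mul_rpow_le hα hα0 hβ hβ0 ht
  have hc : 0 ≤ 2 ^ ((d : ℝ) / 2) * M := by positivity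
  simp only [ENNReal.ofReal_mul hc]
  rw [lintegral_const_mul _ (by fun_prop)]
  calc _ ≤ _ := mul_le_mul_right h2 _
    _ = _ := by
      rw [← ENNReal.ofReal_mul hc]; congr 1; unfold duhamelConst; ring

theorem duhamelQuot_le {d m : ℕ} {f : ℝ → Ed d → Ed m}
    (hf : Measurable (Function.uncurry f)) {a β M t : ℝ} (ha : 1 ≤ a) (hβ : β < 1) (hβ0 : 0 ≤ β)
    (hM : 0 ≤ M) (ht : 0 < t) (hα : 1 / 2 + (d : ℝ) / (2 * a) < 1)
    (h : ForcingBound d m f a β M t) (v x : Ed d) :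
    duhamelQuot d m f t v x ≤ ENNReal.ofReal (duhamelConst d (1 / 2 + (d : ℝ) / (2 * a)) β * M *
      t ^ (1 - (1 / 2 + (d : ℝ) / (2 * a)) - β)) := by
  have hfs : ∀ s, Measurable (f s) := fun s => hf.comp (measurable_const.prodMk measurable_id)
  refine le_trans (setLIntegral_mono' measurableSet_Ioo fun s hs => ?_)
    (lintegral_duhamel_weight_le hα (by positivity) hβ hβ0 hM ht)
  have hts : 0 < t - s := by linarith [hs.2]
  have hs0 := hs.1
  have hK : Measurable fun z => gradKernel d (t - s) v z :=
    (measurable_gradKernel d v).comp (f := fun z => (t - s, z)) (by fun_prop)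
  refine (lintegral_conv_le ha hK (hfs s).enorm.aemeasurable (lintegral_gradKernel hts v).le
    (gradKernel_le hts v) (h s hs) x).trans (le_of_eq ?_)
  rw [ENNReal.ofReal_rpow_of_nonneg (by positivity) (by positivity),
    ← ENNReal.ofReal_mul (by positivity), ← ENNReal.ofReal_mul (by positivity),
    ← Real.rpow_mul hts.le]
  congr 1
  have e : (t - s) ^ (-(1 / 2 + (d : ℝ) / (2 * a)))
      = (t - s) ^ (-(1 : ℝ) / 2) * (t - s) ^ (-(d : ℝ) / 2 * (1 / a)) := by
    rw [← Real.rpow_add hts]; congr 1; field_simp; ring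
  rw [e]; ring

theorem lintegral_duhamelQuot_rpow_le {d m : ℕ} {f : ℝ → Ed d → Ed m}
    (hf : Measurable (Function.uncurry f)) {a q α β M t : ℝ} (ha : 1 ≤ a) (haq : a ≤ q)
    (hβ : β < 1) (hβ0 : 0 ≤ β) (hM : 0 < M) (ht : 0 < t)
    (hα : α = 1 / 2 + (d : ℝ) / 2 * (1 / a - 1 / q)) (hα1 : α < 1)
    (h : ForcingBound d m f a β M t) (v : Ed d) :
    ∫⁻ x, duhamelQuot d m f t v x ^ q ≤
      ENNReal.ofReal (duhamelConst d α β * M * t ^ (1 - α - β)) ^ q := by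
  have hfs : ∀ s, Measurable (f s) := fun s => hf.comp (measurable_const.prodMk measurable_id)
  have ha0 : 0 < a := by linarith
  have hq0 : 0 < q := by linarith
  have haq' : 0 ≤ 1 / a - 1 / q := sub_nonneg.2 (one_div_le_one_div_of_le ha0 haq)
  have hα0 : 0 ≤ α := by rw [hα]; positivity
  have hpos : ∀ s ∈ Set.Ioo 0 t, 0 < 2 ^ ((d : ℝ) / 2) * M * ((t - s) ^ (-α) * s ^ (-β)) := by
    intro s hs
    have hts : 0 < t - s := by linarith [hs.2]
    have hs0 := hs.1
    positivity
  refine le_trans (lintegral_lintegral_rpow_le (q := q)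
    (ω := fun s => ENNReal.ofReal (2 ^ ((d : ℝ) / 2) * M * ((t - s) ^ (-α) * s ^ (-β))))
    (by linarith) (measurable_duhamelQuot_integrand hf t v) (by fun_prop) ?_ ?_ ?_) ?_
  · filter_upwards [ae_restrict_mem measurableSet_Ioo] with s hs
    exact (ENNReal.ofReal_pos.2 (hpos s hs)).ne'
  · exact Eventually.of_forall fun s => ENNReal.ofReal_ne_top
  · filter_upwards [ae_restrict_mem measurableSet_Ioo] with s hs
    have hts : 0 < t - s := by linarith [hs.2]
    have hs0 := hs.1
    have hK : Measurable fun z => gradKernel d (t - s) v z :=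
      (measurable_gradKernel d v).comp (f := fun z => (t - s, z)) (by fun_prop)
    refine (lintegral_conv_rpow_le ha haq hK (hfs s).enorm (lintegral_gradKernel hts v).le
      (gradKernel_le hts v) (h s hs)).trans (le_of_eq ?_)
    congr 1
    rw [ENNReal.ofReal_rpow_of_nonneg (by positivity) haq',
      ← ENNReal.ofReal_mul (by positivity), ← ENNReal.ofReal_mul (by positivity),
      ← Real.rpow_mul hts.le]
    congr 1
    have e : (t - s) ^ (-α)
        = (t - s) ^ (-(1 : ℝ) / 2) * (t - s) ^ (-(d : ℝ) / 2 * (1 / a - 1 / q)) := by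
      rw [← Real.rpow_add hts, hα]; congr 1; ring
    rw [e]; ring
  · exact ENNReal.rpow_le_rpow (lintegral_duhamel_weight_le hα1 hα0 hβ hβ0 hM.le ht) hq0.le

theorem eLpNorm_fderiv_duhamel_le {d m : ℕ} {f : ℝ → Ed d → Ed m}
    (hf : Measurable (Function.uncurry f)) {a q α β M t : ℝ} (ha : 1 ≤ a) (haq : a ≤ q)
    (hβ : β < 1) (hβ0 : 0 ≤ β) (hM : 0 < M) (ht : 0 < t) (hda : (d : ℝ) / (2 * a) < 1)
    (hα : α = 1 / 2 + (d : ℝ) / 2 * (1 / a - 1 / q)) (hα1 : α < 1)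
    (h : ForcingBound d m f a β M t) :
    eLpNorm (fderiv ℝ (duhamel d m f t)) (ENNReal.ofReal q) volume ≤
      ENNReal.ofReal (d * (duhamelConst d α β * M * t ^ (1 - α - β))) := by
  rw [ENNReal.ofReal_mul (by positivity), ENNReal.ofReal_natCast]
  refine eLpNorm_fderiv_le (stronglyMeasurable_duhamel hf t) (by linarith) fun v =>
    ⟨duhamelQuot d m f t v, fun x => enorm_duhamel_sub_le hf ha hβ hβ0 hM.le ht hda h v x, ?_⟩
  exact lintegral_duhamelQuot_rpow_le hf ha haq hβ hβ0 hM ht hα hα1 h v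

theorem norm_fderiv_duhamel_le {d m : ℕ} {f : ℝ → Ed d → Ed m}
    (hf : Measurable (Function.uncurry f)) {a β M t : ℝ} (ha : 1 ≤ a) (hβ : β < 1) (hβ0 : 0 ≤ β)
    (hM : 0 ≤ M) (ht : 0 < t) (hα : 1 / 2 + (d : ℝ) / (2 * a) < 1)
    (h : ForcingBound d m f a β M t) (x : Ed d) :
    ‖fderiv ℝ (duhamel d m f t) x‖ ≤ duhamelConst d (1 / 2 + (d : ℝ) / (2 * a)) β * M *
      t ^ (1 - (1 / 2 + (d : ℝ) / (2 * a)) - β) := by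
  have hc := duhamelConst_pos (d := d) hα hβ
  have hL : 0 ≤ duhamelConst d (1 / 2 + (d : ℝ) / (2 * a)) β * M *
      t ^ (1 - (1 / 2 + (d : ℝ) / (2 * a)) - β) := by positivity
  refine norm_fderiv_le_of_lip' ℝ hL (Eventually.of_forall fun z => ?_)
  have h1 := enorm_duhamel_sub_le hf ha hβ hβ0 hM ht (by linarith) h (z - x) x
  have h2 := h1.trans (mul_le_mul_right (duhamelQuot_le hf ha hβ hβ0 hM ht hα h (z - x) x) _)
  rw [add_sub_cancel, ← ofReal_norm, ← ofReal_norm, ← ENNReal.ofReal_mul (norm_nonneg _),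
    ENNReal.ofReal_le_ofReal_iff (by positivity)] at h2
  rwa [mul_comm] at h2

/-- The points at which the heat extension at time `t` is given by a convergent integral. -/
def heatDomain (d m : ℕ) (t : ℝ) (u : Ed d → Ed m) : Set (Ed d) :=
  {x | Integrable fun y => heatKernel d t (x - y) • u y}

theorem continuous_heatKernel_sub (d : ℕ) (t : ℝ) (x : Ed d) :
    Continuous fun y => heatKernel d t (x - y) :=
  (continuous_heatKernel d t).comp (continuous_const.sub continuous_id)

theorem aestronglyMeasurable_of_mem_heatDomain {d m : ℕ} {t : ℝ} (ht : 0 < t) {u : Ed d → Ed m}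
    {x : Ed d} (hx : x ∈ heatDomain d m t u) : AEStronglyMeasurable u volume := by
  have h1 : Continuous fun y => (heatKernel d t (x - y))⁻¹ :=
    (continuous_heatKernel_sub d t x).inv₀ fun y => (heatKernel_pos ht _).ne'
  have hx' : Integrable fun y => heatKernel d t (x - y) • u y := hx
  refine (h1.aestronglyMeasurable.smul hx'.aestronglyMeasurable).congr
    (Eventually.of_forall fun y => ?_)
  simp [smul_smul, inv_mul_cancel₀ (heatKernel_pos ht (x - y)).ne']

theorem convex_heatDomain {d m : ℕ} {t : ℝ} (ht : 0 < t) (u : Ed d → Ed m) :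
    Convex ℝ (heatDomain d m t u) := by
  intro x hx x' hx' a b ha hb hab
  have hu := aestronglyMeasurable_of_mem_heatDomain ht hx
  have hx1 : Integrable fun y => heatKernel d t (x - y) • u y := hx
  have hx2 : Integrable fun y => heatKernel d t (x' - y) • u y := hx'
  refine ((hx1.norm.add hx2.norm).const_mul (Real.exp (‖x - x'‖ ^ 2 / (4 * t)))).mono'
    ((continuous_heatKernel_sub d t _).aestronglyMeasurable.smul hu)
    (Eventually.of_forall fun y => ?_)
  simp only [Pi.add_apply, norm_smul, Real.norm_of_nonneg (heatKernel_pos ht _).le]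
  rw [← add_mul, ← mul_assoc]
  exact mul_le_mul_of_nonneg_right (heatKernel_convexComb_le ht x x' y ha hb hab) (norm_nonneg _)

theorem mem_heatDomain_of_mem {d m : ℕ} {s t : ℝ} (hs : 0 < s) (hst : 2 * s ≤ t)
    {u : Ed d → Ed m} {x : Ed d} (hx : x ∈ heatDomain d m t u) (z : Ed d) :
    z ∈ heatDomain d m s u := by
  have ht : 0 < t := by linarith
  have hu := aestronglyMeasurable_of_mem_heatDomain ht hx
  have hx1 : Integrable fun y => heatKernel d t (x - y) • u y := hx
  refine (hx1.norm.const_mul ((4 * Real.pi * s) ^ (-(d : ℝ) / 2) *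
      ((4 * Real.pi * t) ^ (-(d : ℝ) / 2))⁻¹ * Real.exp (‖x - z‖ ^ 2 / (4 * s)))).mono'
    ((continuous_heatKernel_sub d s z).aestronglyMeasurable.smul hu)
    (Eventually.of_forall fun y => ?_)
  rw [norm_smul, norm_smul, Real.norm_of_nonneg (heatKernel_pos ht _).le,
    Real.norm_of_nonneg (heatKernel_pos hs _).le, ← mul_assoc]
  exact mul_le_mul_of_nonneg_right (heatKernel_le_mul hs hst x z y) (norm_nonneg _)

theorem exists_hasFDerivAt_heatConv {d m : ℕ} {s t : ℝ} (hs : 0 < s) (hst : 4 * s ≤ t)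
    {u : Ed d → Ed m} {x : Ed d} (hx : x ∈ heatDomain d m t u) (R : ℝ) :
    ∃ K : ℝ, ∀ z ∈ Metric.ball x R, DifferentiableAt ℝ (heatConv d s u) z ∧
      ‖fderiv ℝ (heatConv d s u) z‖ ≤ K := by
  have ht : 0 < t := by linarith
  have hu := aestronglyMeasurable_of_mem_heatDomain ht hx
  have hx1 : Integrable fun y => heatKernel d t (x - y) • u y := hx
  set C := 2 ^ ((d : ℝ) / 2) * s ^ (-(1 : ℝ) / 2) * ((4 * Real.pi * (2 * s)) ^ (-(d : ℝ) / 2) *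
      ((4 * Real.pi * t) ^ (-(d : ℝ) / 2))⁻¹ * Real.exp (R ^ 2 / (4 * (2 * s)))) with hC
  have hC0 : 0 ≤ C := by positivity
  set F' : Ed d → Ed d → Ed d →L[ℝ] Ed m := fun z y =>
    ((-(heatKernel d s (z - y) / (2 * s)) • innerSL ℝ (z - y)) : Ed d →L[ℝ] ℝ).smulRight (u y)
    with hF'
  have hbound : ∀ y, ∀ z ∈ Metric.ball x R, ‖F' z y‖ ≤ C * ‖heatKernel d t (x - y) • u y‖ := by
    intro y z hz
    have hR : ‖x - z‖ ≤ R := by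
      rw [← dist_eq_norm, dist_comm]; exact (Metric.mem_ball.1 hz).le
    have h1 := norm_mul_heatKernel_le hs (z - y)
    have h2 := heatKernel_le_mul (s := 2 * s) (t := t) (by positivity) (by linarith) x z y
    have h3 : Real.exp (‖x - z‖ ^ 2 / (4 * (2 * s))) ≤ Real.exp (R ^ 2 / (4 * (2 * s))) := by
      gcongr
    have hk := heatKernel_pos hs (z - y)
    have hk2 := heatKernel_pos ht (x - y)
    have e : ‖F' z y‖ = ‖z - y‖ / (2 * s) * heatKernel d s (z - y) * ‖u y‖ := by
      rw [hF']
      simp only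
      rw [ContinuousLinearMap.norm_smulRight_apply, norm_smul, norm_neg, norm_div,
        Real.norm_of_nonneg hk.le, Real.norm_of_nonneg (by positivity : 0 ≤ 2 * s),
        innerSL_apply_norm]
      ring
    rw [e, norm_smul, Real.norm_of_nonneg hk2.le, ← mul_assoc]
    refine mul_le_mul_of_nonneg_right ?_ (norm_nonneg _)
    calc _ ≤ _ := h1
      _ ≤ 2 ^ ((d : ℝ) / 2) * s ^ (-(1 : ℝ) / 2) * ((4 * Real.pi * (2 * s)) ^ (-(d : ℝ) / 2) *
          ((4 * Real.pi * t) ^ (-(d : ℝ) / 2))⁻¹ * Real.exp (R ^ 2 / (4 * (2 * s))) *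
          heatKernel d t (x - y)) := by
        refine mul_le_mul_of_nonneg_left (h2.trans ?_) (by positivity)
        gcongr
      _ = _ := by rw [hC]; ring
  have hint : Integrable fun y => C * ‖heatKernel d t (x - y) • u y‖ := hx1.norm.const_mul C
  have hd : ∀ z ∈ Metric.ball x R, HasFDerivAt (heatConv d s u) (∫ y, F' z y) z := by
    intro z hz
    refine hasFDerivAt_integral_of_dominated_of_fderiv_le
      (F := fun z y => heatKernel d s (z - y) • u y) (F' := F')
      (Metric.isOpen_ball.mem_nhds hz) (Eventually.of_forall fun w => ?_)
      (mem_heatDomain_of_mem hs (by linarith) hx z) ?_ (Eventually.of_forall hbound) hint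
      (Eventually.of_forall fun y w _ => ?_)
    · exact (continuous_heatKernel_sub d s w).aestronglyMeasurable.smul hu
    · have h1 : Continuous fun y : Ed d =>
          (-(heatKernel d s (z - y) / (2 * s)) • innerSL ℝ (z - y) : Ed d →L[ℝ] ℝ) := by
        have := continuous_heatKernel_sub d s z
        fun_prop
      exact (ContinuousLinearMap.smulRightL ℝ (Ed d) (Ed m)).aestronglyMeasurable_comp₂
        h1.aestronglyMeasurable hu
    · have h1 := HasFDerivAt.comp (g := heatKernel d s) (f := fun w => w - y) w
        (hasFDerivAt_heatKernel hs (w - y)) ((hasFDerivAt_id w).sub_const y)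
      exact (h1.smul_const (u y)).congr_fderiv (by simp [hF'])
  refine ⟨∫ y, C * ‖heatKernel d t (x - y) • u y‖, fun z hz => ⟨(hd z hz).differentiableAt, ?_⟩⟩
  rw [(hd z hz).fderiv]
  exact norm_integral_le_of_norm_le hint (Eventually.of_forall fun y => hbound y z hz)

theorem integral_heatKernel_mul {d : ℕ} {t : ℝ} (ht : 0 < t) (x y : Ed d) :
    ∫ z, heatKernel d t (x - z) * heatKernel d t (z - y) = heatKernel d (2 * t) (x - y) := by
  have h2t : 0 < 2 * t := by positivity
  rw [integral_eq_lintegral_of_nonneg_ae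
    (Eventually.of_forall fun z => (mul_pos (heatKernel_pos ht _) (heatKernel_pos ht _)).le)]
  · simp only [ENNReal.ofReal_mul (heatKernel_pos ht _).le]
    rw [lintegral_heatKernel_mul ht x y, ENNReal.toReal_ofReal (heatKernel_pos h2t _).le]
  · refine Continuous.aestronglyMeasurable ?_
    exact (continuous_heatKernel_sub d t x).mul
      ((continuous_heatKernel d t).comp (continuous_id.sub continuous_const))

theorem heatConv_heatConv {d m : ℕ} {t : ℝ} (ht : 0 < t) {u : Ed d → Ed m} {x : Ed d}
    (hx : x ∈ heatDomain d m (2 * t) u) :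
    x ∈ heatDomain d m t (heatConv d t u) ∧
      heatConv d t (heatConv d t u) x = heatConv d (2 * t) u x := by
  have h2t : 0 < 2 * t := by positivity
  have hu := aestronglyMeasurable_of_mem_heatDomain h2t hx
  have hx1 : Integrable fun y => heatKernel d (2 * t) (x - y) • u y := hx
  have hm : AEStronglyMeasurable (fun w : Ed d × Ed d =>
      heatKernel d t (x - w.1) • heatKernel d t (w.1 - w.2) • u w.2)
      ((volume : Measure (Ed d)).prod volume) := by
    have h1 : Continuous fun w : Ed d × Ed d => heatKernel d t (x - w.1) :=
      (continuous_heatKernel d t).comp (continuous_const.sub continuous_fst)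
    have h2 : Continuous fun w : Ed d × Ed d => heatKernel d t (w.1 - w.2) :=
      (continuous_heatKernel d t).comp (continuous_fst.sub continuous_snd)
    exact h1.aestronglyMeasurable.smul (h2.aestronglyMeasurable.smul hu.comp_snd)
  have hint : Integrable (fun w : Ed d × Ed d =>
      heatKernel d t (x - w.1) • heatKernel d t (w.1 - w.2) • u w.2)
      ((volume : Measure (Ed d)).prod volume) := by
    refine ⟨hm, ?_⟩
    unfold HasFiniteIntegral
    rw [lintegral_prod_symm _ hm.enorm]
    refine lt_of_le_of_lt (lintegral_mono fun y => ?_) hx1.2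
    rw [enorm_smul, Real.enorm_of_nonneg (heatKernel_pos h2t _).le,
      ← lintegral_heatKernel_mul ht x y]
    have hk : Measurable fun z => ENNReal.ofReal (heatKernel d t (x - z)) *
        ENNReal.ofReal (heatKernel d t (z - y)) :=
      ((measurable_ofReal_heatKernel d t).comp (measurable_const.sub measurable_id)).mul
        ((measurable_ofReal_heatKernel d t).comp (measurable_id.sub measurable_const))
    rw [← lintegral_mul_const _ hk]
    refine lintegral_mono fun z => ?_
    simp only
    rw [enorm_smul, enorm_smul, Real.enorm_of_nonneg (heatKernel_pos ht _).le,
      Real.enorm_of_nonneg (heatKernel_pos ht _).le, mul_assoc]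
  refine ⟨?_, ?_⟩
  · have h := hint.integral_prod_left
    simp only [integral_smul] at h
    exact h
  · have h := integral_integral_swap (f := fun z y =>
      heatKernel d t (x - z) • heatKernel d t (z - y) • u y) hint
    simp only [integral_smul] at h
    unfold heatConv
    rw [h]
    refine integral_congr_ae (Eventually.of_forall fun y => ?_)
    simp only [smul_smul]
    rw [integral_smul_const, integral_heatKernel_mul ht]

theorem heatConv_eq_integral_comp_sub {d m : ℕ} (t : ℝ) (g : Ed d → Ed m) (x : Ed d) :
    heatConv d t g x = ∫ y, heatKernel d t y • g (x - y) := by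
  unfold heatConv
  rw [← integral_sub_left_eq_self _ volume x]
  simp

theorem integrable_heatKernel_smul_comp_sub {d m : ℕ} {t : ℝ} {g : Ed d → Ed m} {x : Ed d}
    (hx : x ∈ heatDomain d m t g) : Integrable fun y => heatKernel d t y • g (x - y) := by
  have hx1 : Integrable fun y => heatKernel d t (x - y) • g y := hx
  simpa using hx1.comp_sub_left x

theorem heatConv_sub_heatConv {d m : ℕ} {t : ℝ} {g : Ed d → Ed m} {x x' : Ed d}
    (hx : x ∈ heatDomain d m t g) (hx' : x' ∈ heatDomain d m t g) :
    heatConv d t g x - heatConv d t g x' = ∫ y, heatKernel d t y • (g (x - y) - g (x' - y)) := by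
  rw [heatConv_eq_integral_comp_sub, heatConv_eq_integral_comp_sub,
    ← integral_sub (integrable_heatKernel_smul_comp_sub hx)
      (integrable_heatKernel_smul_comp_sub hx')]
  simp only [smul_sub]

/-- A mean value inequality for functions whose derivative is only locally bounded. -/
theorem enorm_sub_le_lintegral_fderiv {d m : ℕ} {g : Ed d → Ed m} (hg : Differentiable ℝ g)
    (hb : ∀ R, ∃ K : ℝ, ∀ z ∈ Metric.ball (0 : Ed d) R, ‖fderiv ℝ g z‖ ≤ K) (z v : Ed d) :
    ‖g (z + v) - g z‖ₑ ≤ ∫⁻ r in Set.Ioc (0 : ℝ) 1, ‖v‖ₑ * ‖fderiv ℝ g (z + r • v)‖ₑ := by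
  have hline : ∀ r : ℝ, HasDerivAt (fun r : ℝ => g (z + r • v)) (fderiv ℝ g (z + r • v) v) r := by
    intro r
    have h1 : HasDerivAt (fun r : ℝ => z + r • v) v r := by
      simpa using ((hasDerivAt_id r).smul_const v).const_add z
    exact (hg (z + r • v)).hasFDerivAt.comp_hasDerivAt r h1
  have hmeas : Measurable fun r : ℝ => fderiv ℝ g (z + r • v) v := by
    have h1 : Measurable fun r : ℝ => z + r • v := by fun_prop
    exact ((measurable_fderiv ℝ g).comp h1).apply_continuousLinearMap v
  obtain ⟨K, hK⟩ := hb (‖z‖ + ‖v‖ + 1)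
  have hint : IntervalIntegrable (fun r : ℝ => fderiv ℝ g (z + r • v) v) volume 0 1 := by
    refine (intervalIntegrable_const (c := K * ‖v‖)).mono_fun' hmeas.aestronglyMeasurable ?_
    rw [uIoc_of_le zero_le_one]
    filter_upwards [ae_restrict_mem measurableSet_Ioc] with r hr
    refine (ContinuousLinearMap.le_opNorm _ _).trans
      (mul_le_mul_of_nonneg_right (hK _ ?_) (norm_nonneg _))
    rw [mem_ball_zero_iff]
    have : ‖r • v‖ ≤ ‖v‖ := by
      rw [norm_smul, Real.norm_of_nonneg hr.1.le]
      exact mul_le_of_le_one_left (norm_nonneg _) hr.2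
    linarith [norm_add_le z (r • v)]
  have h := intervalIntegral.integral_eq_sub_of_hasDerivAt (fun r _ => hline r) hint
  simp only [one_smul, zero_smul, add_zero] at h
  rw [← h, intervalIntegral.integral_of_le zero_le_one]
  refine (enorm_integral_le_lintegral_enorm _).trans (lintegral_mono fun r => ?_)
  simp only
  rw [mul_comm]
  exact ContinuousLinearMap.le_opENorm _ _

theorem enorm_heatConv_two_mul_sub_le {d m : ℕ} {τ p M : ℝ} (hτ : 0 < τ) (hp : 1 ≤ p)
    (hM0 : 0 ≤ M) {u : Ed d → Ed m} {x₀ : Ed d} (hx₀ : x₀ ∈ heatDomain d m (4 * τ) u)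
    (hM : ∫⁻ y, ‖fderiv ℝ (heatConv d τ u) y‖ₑ ^ p ≤ ENNReal.ofReal M ^ p) (z v : Ed d) :
    ‖heatConv d (2 * τ) u (z + v) - heatConv d (2 * τ) u z‖ₑ ≤
      ‖v‖ₑ * ENNReal.ofReal (M * τ ^ (-((d : ℝ) / (2 * p)))) := by
  set g := heatConv d τ u with hg
  have hdom : ∀ w, w ∈ heatDomain d m (2 * τ) u :=
    mem_heatDomain_of_mem (by positivity) (by linarith) hx₀
  have hdiff : Differentiable ℝ g := by
    intro w
    obtain ⟨K, hK⟩ := exists_hasFDerivAt_heatConv hτ le_rfl hx₀ (dist w x₀ + 1)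
    exact (hK w (by simp)).1
  have hb : ∀ R, ∃ K : ℝ, ∀ w ∈ Metric.ball (0 : Ed d) R, ‖fderiv ℝ g w‖ ≤ K := by
    intro R
    obtain ⟨K, hK⟩ := exists_hasFDerivAt_heatConv hτ le_rfl hx₀ (R + dist 0 x₀)
    exact ⟨K, fun w hw => (hK w (Metric.ball_subset_ball' le_rfl hw)).2⟩
  have hmF : Measurable (fderiv ℝ g) := measurable_fderiv ℝ g
  have hsg := fun w => heatConv_heatConv hτ (hdom w)
  rw [← (hsg (z + v)).2, ← (hsg z).2, heatConv_sub_heatConv (hsg (z + v)).1 (hsg z).1]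
  have hmeas : Measurable fun w : Ed d × ℝ =>
      ENNReal.ofReal (heatKernel d τ w.1) * (‖v‖ₑ * ‖fderiv ℝ g (z - w.1 + w.2 • v)‖ₑ) := by
    have h1 : Measurable fun w : Ed d × ℝ => z - w.1 + w.2 • v := by fun_prop
    exact ((measurable_ofReal_heatKernel d τ).comp measurable_fst).mul
      (measurable_const.mul (hmF.comp h1).enorm)
  calc _ ≤ ∫⁻ y, ‖heatKernel d τ y • (g (z + v - y) - g (z - y))‖ₑ :=
        enorm_integral_le_lintegral_enorm _
    _ ≤ ∫⁻ y, ∫⁻ r in Set.Ioc (0 : ℝ) 1,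
          ENNReal.ofReal (heatKernel d τ y) * (‖v‖ₑ * ‖fderiv ℝ g (z - y + r • v)‖ₑ) := by
        refine lintegral_mono fun y => ?_
        simp only
        rw [enorm_smul, Real.enorm_of_nonneg (heatKernel_pos hτ _).le,
          lintegral_const_mul' _ _ ENNReal.ofReal_ne_top, add_sub_right_comm]
        exact mul_le_mul_right (enorm_sub_le_lintegral_fderiv hdiff hb _ _) _
    _ = ∫⁻ r in Set.Ioc (0 : ℝ) 1, ∫⁻ y,
          ENNReal.ofReal (heatKernel d τ y) * (‖v‖ₑ * ‖fderiv ℝ g (z - y + r • v)‖ₑ) :=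
        lintegral_lintegral_swap hmeas.aemeasurable
    _ ≤ ∫⁻ r in Set.Ioc (0 : ℝ) 1, ‖v‖ₑ * ENNReal.ofReal (M * τ ^ (-((d : ℝ) / (2 * p)))) := by
        refine lintegral_mono fun r => ?_
        have h1 := lintegral_heatKernel_mul_le hp hτ hM0 hmF.enorm.aemeasurable hM (z + r • v)
        rw [← lintegral_sub_left_eq_self _ (z + r • v)] at h1
        simp only [sub_sub_cancel] at h1
        refine le_trans (le_of_eq ?_) (mul_le_mul_right h1 ‖v‖ₑ)
        rw [← lintegral_const_mul' _ _ enorm_ne_top]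
        refine lintegral_congr fun y => ?_
        rw [mul_left_comm, sub_add_eq_add_sub]
    _ = _ := by simp

theorem lipschitzOnWith_heatConv {d m : ℕ} {τ p M : ℝ} (hτ : 0 < τ) (hp : 1 ≤ p)
    (hM0 : 0 ≤ M) {u : Ed d → Ed m}
    (hM : ∫⁻ y, ‖fderiv ℝ (heatConv d τ u) y‖ₑ ^ p ≤ ENNReal.ofReal M ^ p) :
    LipschitzOnWith (Real.toNNReal (M * τ ^ (-((d : ℝ) / (2 * p))))) (heatConv d (4 * τ) u)
      (heatDomain d m (4 * τ) u) := by
  intro x hx x' hx'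
  have h2τ : 0 < 2 * τ := by positivity
  set g := heatConv d (2 * τ) u with hg
  have e : 4 * τ = 2 * (2 * τ) := by ring
  have h1 := heatConv_heatConv h2τ (e ▸ hx)
  have h2 := heatConv_heatConv h2τ (e ▸ hx')
  rw [edist_eq_enorm_sub, edist_eq_enorm_sub, e, ← h1.2, ← h2.2, heatConv_sub_heatConv h1.1 h2.1]
  have hlip := enorm_heatConv_two_mul_sub_le hτ hp hM0 hx hM
  calc _ ≤ ∫⁻ y, ‖heatKernel d (2 * τ) y • (g (x - y) - g (x' - y))‖ₑ :=
        enorm_integral_le_lintegral_enorm _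
    _ ≤ ∫⁻ y, ENNReal.ofReal (heatKernel d (2 * τ) y) *
          (‖x - x'‖ₑ * ENNReal.ofReal (M * τ ^ (-((d : ℝ) / (2 * p))))) := by
        refine lintegral_mono fun y => ?_
        simp only
        rw [enorm_smul, Real.enorm_of_nonneg (heatKernel_pos h2τ _).le]
        refine mul_le_mul_right ?_ _
        have h3 := hlip (x' - y) (x - x')
        rwa [show x' - y + (x - x') = x - y by abel] at h3
    _ = _ := by
        rw [lintegral_mul_const _ (measurable_ofReal_heatKernel d (2 * τ)),
          lintegral_heatKernel h2τ, one_mul, mul_comm]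
        rfl

theorem ae_differentiableAt_heatConv {d m : ℕ} {t p M : ℝ} (ht : 0 < t) (hp : 1 ≤ p)
    (hM0 : 0 ≤ M) {u : Ed d → Ed m}
    (hM : ∫⁻ y, ‖fderiv ℝ (heatConv d (t / 4) u) y‖ₑ ^ p ≤ ENNReal.ofReal M ^ p) :
    ∀ᵐ x, DifferentiableAt ℝ (heatConv d t u) x ∧
      ‖fderiv ℝ (heatConv d t u) x‖ ≤ M * (t / 4) ^ (-((d : ℝ) / (2 * p))) := by
  have hL : 0 ≤ M * (t / 4) ^ (-((d : ℝ) / (2 * p))) := by positivity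
  have hlip := lipschitzOnWith_heatConv (by positivity : 0 < t / 4) hp hM0 hM
  rw [show 4 * (t / 4) = t by ring] at hlip
  set D := heatDomain d m t u with hD
  have hlip' := hlip.mono (interior_subset (s := D))
  have hfr : ∀ᵐ x, x ∉ frontier D :=
    measure_eq_zero_iff_ae_notMem.1 ((convex_heatDomain ht u).addHaar_frontier volume)
  filter_upwards [hfr, hlip'.ae_differentiableWithinAt_of_mem (μ := volume)] with x hx hdx
  by_cases hxi : x ∈ interior D
  · have hnhds := isOpen_interior.mem_nhds hxi
    refine ⟨(hdx hxi).differentiableAt hnhds, ?_⟩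
    have := norm_fderiv_le_of_lipschitzOn ℝ hnhds hlip'
    rwa [Real.coe_toNNReal _ hL] at this
  · have hxc : x ∈ (closure D)ᶜ := fun h => hx ⟨h, hxi⟩
    have hz : heatConv d t u =ᶠ[nhds x] fun _ => 0 := by
      filter_upwards [isClosed_closure.isOpen_compl.mem_nhds hxc] with w hw
      exact integral_undef fun h => hw (subset_closure h)
    refine ⟨hz.differentiableAt_iff.2 (differentiableAt_const _), ?_⟩
    rw [hz.fderiv_eq]
    simpa using hL

theorem eLpNorm_ofReal_le_iff {α F : Type*} [MeasurableSpace α] [NormedAddCommGroup F]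
    {μ : Measure α} {q : ℝ} (hq : 0 < q) {w : α → F} {L : ℝ≥0∞} :
    eLpNorm w (ENNReal.ofReal q) μ ≤ L ↔ ∫⁻ x, ‖w x‖ₑ ^ q ∂μ ≤ L ^ q := by
  rw [eLpNorm_eq_lintegral_rpow_enorm_toReal (ENNReal.ofReal_pos.2 hq).ne' ENNReal.ofReal_ne_top,
    ENNReal.toReal_ofReal hq.le, one_div, ENNReal.rpow_inv_le_iff hq]

/-- The scaling exponent of the `L^q` norm of the gradient. -/
def gradExp (d : ℕ) (q : ℝ) : ℝ := 1 / 2 - d / (2 * q)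

theorem eLpNorm_fderiv_heatConv_le_besov {d m : ℕ} {p b t : ℝ} (ht : 0 < t)
    {u : Ed d → Ed m} (hb : besovNorm d m p u ≤ ENNReal.ofReal b) :
    eLpNorm (fderiv ℝ (heatConv d t u)) (ENNReal.ofReal p) volume ≤
      ENNReal.ofReal (b * t ^ (-gradExp d p)) := by
  have h1 : ENNReal.ofReal (t ^ gradExp d p) *
      eLpNorm (fderiv ℝ (heatConv d t u)) (ENNReal.ofReal p) volume ≤ ENNReal.ofReal b :=
    (le_iSup (fun t : Set.Ioi (0 : ℝ) => ENNReal.ofReal ((t : ℝ) ^ ((1 : ℝ) / 2 - d / (2 * p))) *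
      eLpNorm (fun x => fderiv ℝ (heatConv d (t : ℝ) u) x) (ENNReal.ofReal p) volume)
      ⟨t, ht⟩).trans hb
  have hpos : 0 < t ^ gradExp d p := by positivity
  rw [Real.rpow_neg ht.le, ← div_eq_mul_inv, ENNReal.ofReal_div_of_pos hpos,
    ENNReal.le_div_iff_mul_le (Or.inl (ENNReal.ofReal_pos.2 hpos).ne')
      (Or.inl ENNReal.ofReal_ne_top), mul_comm]
  exact h1

theorem ae_norm_fderiv_heatConv_le {d m : ℕ} {p b t : ℝ} (hp : 1 ≤ p) (hb0 : 0 ≤ b) (ht : 0 < t)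
    {u : Ed d → Ed m} (hb : besovNorm d m p u ≤ ENNReal.ofReal b) :
    ∀ᵐ x, DifferentiableAt ℝ (heatConv d t u) x ∧
      ‖fderiv ℝ (heatConv d t u) x‖ ≤ 2 * b * t ^ (-(1 / 2) : ℝ) := by
  have h4 : 0 < t / 4 := by positivity
  have h := ae_differentiableAt_heatConv ht hp (by positivity)
    ((eLpNorm_ofReal_le_iff (by linarith)).1 (eLpNorm_fderiv_heatConv_le_besov h4 hb))
  filter_upwards [h] with x hx
  refine ⟨hx.1, hx.2.trans (le_of_eq ?_)⟩
  rw [mul_assoc, ← Real.rpow_add h4, gradExp,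
    show -(1 / 2 - (d : ℝ) / (2 * p)) + -((d : ℝ) / (2 * p)) = -(1 / 2) by ring,
    Real.div_rpow ht.le (by norm_num), show (4 : ℝ) = 2 ^ (2 : ℝ) by norm_num,
    ← Real.rpow_mul (by norm_num), show (2 : ℝ) * -(1 / 2) = -1 by norm_num,
    Real.rpow_neg_one]
  field_simp

theorem eLpNorm_fderiv_heatConv_le {d m : ℕ} {p q b t : ℝ} (hp : 1 ≤ p) (hpq : p ≤ q)
    (hb0 : 0 ≤ b) (ht : 0 < t) {u : Ed d → Ed m} (hb : besovNorm d m p u ≤ ENNReal.ofReal b) :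
    eLpNorm (fderiv ℝ (heatConv d t u)) (ENNReal.ofReal q) volume ≤
      ENNReal.ofReal (2 * b * t ^ (-gradExp d q)) := by
  have hp0 : 0 < p := by linarith
  have hq0 : 0 < q := by linarith
  have hqp : 0 ≤ q - p := by linarith
  rw [eLpNorm_ofReal_le_iff hq0]
  calc _ ≤ ∫⁻ x, ENNReal.ofReal (2 * b * t ^ (-(1 / 2) : ℝ)) ^ (q - p) *
        ‖fderiv ℝ (heatConv d t u) x‖ₑ ^ p := by
        refine lintegral_mono_ae ?_
        filter_upwards [ae_norm_fderiv_heatConv_le hp hb0 ht hb] with x hx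
        rw [show q = (q - p) + p by ring, ENNReal.rpow_add_of_nonneg _ _ hqp hp0.le]
        simp only [add_sub_cancel_right]
        refine mul_le_mul_left ?_ _
        refine ENNReal.rpow_le_rpow ?_ hqp
        rw [← ofReal_norm]
        exact ENNReal.ofReal_le_ofReal hx.2
    _ = ENNReal.ofReal (2 * b * t ^ (-(1 / 2) : ℝ)) ^ (q - p) *
        ∫⁻ x, ‖fderiv ℝ (heatConv d t u) x‖ₑ ^ p :=
        lintegral_const_mul' _ _ (ENNReal.rpow_ne_top_of_nonneg hqp ENNReal.ofReal_ne_top)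
    _ ≤ ENNReal.ofReal (2 * b * t ^ (-(1 / 2) : ℝ)) ^ (q - p) *
        ENNReal.ofReal (2 * b * t ^ (-gradExp d p)) ^ p := by
        refine mul_le_mul_right ?_ _
        refine ((eLpNorm_ofReal_le_iff hp0).1 (eLpNorm_fderiv_heatConv_le_besov ht hb)).trans ?_
        gcongr
        linarith
    _ = _ := by
        have hB : 0 ≤ 2 * b := by positivity
        generalize 2 * b = B at hB
        rw [ENNReal.ofReal_rpow_of_nonneg (by positivity) hqp,
          ENNReal.ofReal_rpow_of_nonneg (by positivity) hp0.le,
          ENNReal.ofReal_rpow_of_nonneg (by positivity) hq0.le, ← ENNReal.ofReal_mul (by positivity),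
          Real.mul_rpow (by positivity) (by positivity),
          Real.mul_rpow (by positivity) (by positivity),
          Real.mul_rpow (by positivity) (by positivity), ← Real.rpow_mul ht.le,
          ← Real.rpow_mul ht.le, ← Real.rpow_mul ht.le]
        congr 1
        rw [show -gradExp d q * q = -(1 / 2) * (q - p) + -gradExp d p * p by
          unfold gradExp; field_simp; ring, Real.rpow_add ht]
        nth_rewrite 3 [show q = (q - p) + p by ring]
        rw [Real.rpow_add_of_nonneg (by positivity) hqp hp0.le]
        ring

theorem forcingBound_of_eLpNorm_le {d m : ℕ} {Λ A r t : ℝ} (hΛ : 0 ≤ Λ) (hA : 0 ≤ A) (hr : 0 < r)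
    {u f : ℝ → Ed d → Ed m}
    (hf : ∀ s : ℝ, 0 < s → ∀ x, ‖f s x‖ ≤ Λ * ‖fderiv ℝ (u s) x‖ ^ 2)
    (h : ∀ s ∈ Set.Ioo 0 t, eLpNorm (fderiv ℝ (u s)) (ENNReal.ofReal r) volume ≤
      ENNReal.ofReal (A * s ^ (-gradExp d r))) :
    ForcingBound d m f (r / 2) (1 - d / r) (Λ * A ^ 2) t := by
  intro s hs
  have hs0 := hs.1
  have hr2 : 0 ≤ r / 2 := by positivity
  calc _ ≤ ∫⁻ y, ENNReal.ofReal Λ ^ (r / 2) * ‖fderiv ℝ (u s) y‖ₑ ^ r := by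
        refine lintegral_mono fun y => ?_
        simp only
        have h1 : ‖f s y‖ₑ ≤ ENNReal.ofReal Λ * ‖fderiv ℝ (u s) y‖ₑ ^ (2 : ℝ) := by
          rw [← ofReal_norm, ← ofReal_norm, ENNReal.ofReal_rpow_of_nonneg (norm_nonneg _)
            (by norm_num), ← ENNReal.ofReal_mul hΛ]
          exact ENNReal.ofReal_le_ofReal (by simpa using hf s hs0 y)
        refine (ENNReal.rpow_le_rpow h1 hr2).trans (le_of_eq ?_)
        rw [ENNReal.mul_rpow_of_nonneg _ _ hr2, ← ENNReal.rpow_mul,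
          show (2 : ℝ) * (r / 2) = r by ring]
    _ = ENNReal.ofReal Λ ^ (r / 2) * ∫⁻ y, ‖fderiv ℝ (u s) y‖ₑ ^ r :=
        lintegral_const_mul' _ _ (ENNReal.rpow_ne_top_of_nonneg hr2 ENNReal.ofReal_ne_top)
    _ ≤ ENNReal.ofReal Λ ^ (r / 2) * ENNReal.ofReal (A * s ^ (-gradExp d r)) ^ r :=
        mul_le_mul_right ((eLpNorm_ofReal_le_iff hr).1 (h s hs)) _
    _ = _ := by
        rw [show ENNReal.ofReal (A * s ^ (-gradExp d r)) ^ r =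
          (ENNReal.ofReal (A * s ^ (-gradExp d r)) ^ (2 : ℝ)) ^ (r / 2) by
            rw [← ENNReal.rpow_mul]; congr 1; ring,
          ← ENNReal.mul_rpow_of_nonneg _ _ hr2,
          ENNReal.ofReal_rpow_of_nonneg (by positivity) (by norm_num), ← ENNReal.ofReal_mul hΛ]
        congr 2
        rw [Real.mul_rpow hA (by positivity), ← Real.rpow_mul hs0.le, mul_assoc, Real.rpow_two]
        congr 3
        unfold gradExp
        field_simp

theorem ae_norm_fderiv_le_add {d m : ℕ} {p b t : ℝ} (hp : 1 ≤ p) (hb0 : 0 ≤ b) (ht : 0 < t)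
    {u₀ : Ed d → Ed m} (hb : besovNorm d m p u₀ ≤ ENNReal.ofReal b) {w : Ed d → Ed m}
    {f : ℝ → Ed d → Ed m} (hw : ∀ x, w x = heatConv d t u₀ x + duhamel d m f t x) :
    ∀ᵐ x, ‖fderiv ℝ w x‖ ≤
      ‖fderiv ℝ (heatConv d t u₀) x‖ + ‖fderiv ℝ (duhamel d m f t) x‖ := by
  filter_upwards [ae_norm_fderiv_heatConv_le hp hb0 ht hb] with x hx
  by_cases hd : DifferentiableAt ℝ w x
  · have e : duhamel d m f t = w - heatConv d t u₀ := by
      funext y; simp [hw y]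
    have hN : DifferentiableAt ℝ (duhamel d m f t) x := by
      rw [e]; exact hd.sub hx.1
    have e2 : w = heatConv d t u₀ + duhamel d m f t := funext hw
    rw [e2, fderiv_add hx.1 hN]
    exact norm_add_le _ _
  · rw [fderiv_zero_of_not_differentiableAt hd, norm_zero]
    positivity

/-- A solution of the forced heat equation with quadratic gradient forcing and Besov data of size
at most `b`. -/
structure ForcedFlow (d m : ℕ) (p Λ b : ℝ) (u₀ : Ed d → Ed m) (u f : ℝ → Ed d → Ed m) : Prop where
  measurable : Measurable (Function.uncurry f)
  forcing : ∀ s : ℝ, 0 < s → ∀ x, ‖f s x‖ ≤ Λ * ‖fderiv ℝ (u s) x‖ ^ 2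
  mild : ∀ t : ℝ, 0 < t → ∀ x, u t x = heatConv d t u₀ x + duhamel d m f t x
  besov : besovNorm d m p u₀ ≤ ENNReal.ofReal b

/-- The constant in the `L^r`-to-`L^q` gradient estimate for the flow. -/
def stepConst (d : ℕ) (r q : ℝ) : ℝ :=
  d * duhamelConst d (1 / 2 + (d : ℝ) / 2 * (2 / r - 1 / q)) (1 - d / r)

theorem ForcedFlow.eLpNorm_fderiv_le {d m : ℕ} (hd : 1 ≤ d) {p Λ b r q A t : ℝ}
    {u₀ : Ed d → Ed m} {u f : ℝ → Ed d → Ed m} (h : ForcedFlow d m p Λ b u₀ u f) (hp : 1 ≤ p)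
    (hpq : p ≤ q) (hΛ : 0 < Λ) (hb : 0 ≤ b) (hr : 2 ≤ r) (hdr : d < r) (hrq : r / 2 ≤ q)
    (hα : 1 / 2 + (d : ℝ) / 2 * (2 / r - 1 / q) < 1) (hA : 0 < A) (ht : 0 < t)
    (hu : ∀ s ∈ Set.Ioo 0 t, eLpNorm (fderiv ℝ (u s)) (ENNReal.ofReal r) volume ≤
      ENNReal.ofReal (A * s ^ (-gradExp d r))) :
    eLpNorm (fderiv ℝ (u t)) (ENNReal.ofReal q) volume ≤
      ENNReal.ofReal ((2 * b + stepConst d r q * (Λ * A ^ 2)) * t ^ (-gradExp d q)) := by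
  have hr0 : 0 < r := by linarith
  have hd0 : (0 : ℝ) < d := by exact_mod_cast hd
  have hdr1 : (d : ℝ) / r < 1 := (div_lt_one hr0).2 hdr
  have hdr0 : 0 < (d : ℝ) / r := by positivity
  have hF := forcingBound_of_eLpNorm_le hΛ.le hA.le hr0 h.forcing hu
  have hN := eLpNorm_fderiv_duhamel_le h.measurable (q := q)
    (α := 1 / 2 + (d : ℝ) / 2 * (2 / r - 1 / q)) (by linarith : 1 ≤ r / 2) hrq
    (by linarith : 1 - (d : ℝ) / r < 1) (by linarith) (by positivity) ht
    (by rwa [mul_div_cancel₀ _ (two_ne_zero : (2 : ℝ) ≠ 0)]) (by congr 2; field_simp) hα hF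
  have hH := eLpNorm_fderiv_heatConv_le hp hpq hb ht h.besov
  have hmH : AEStronglyMeasurable (fun x => ‖fderiv ℝ (heatConv d t u₀) x‖) volume :=
    (measurable_fderiv ℝ _).norm.aestronglyMeasurable
  have hmN : AEStronglyMeasurable (fun x => ‖fderiv ℝ (duhamel d m f t) x‖) volume :=
    (measurable_fderiv ℝ _).norm.aestronglyMeasurable
  have hq1 : 1 ≤ ENNReal.ofReal q := by
    rw [ENNReal.one_le_ofReal]; linarith
  have hc := duhamelConst_pos (d := d) hα (by linarith : 1 - (d : ℝ) / r < 1)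
  calc _ ≤ eLpNorm ((fun x => ‖fderiv ℝ (heatConv d t u₀) x‖) +
          fun x => ‖fderiv ℝ (duhamel d m f t) x‖) (ENNReal.ofReal q) volume :=
        eLpNorm_mono_ae_real (ae_norm_fderiv_le_add hp hb ht h.besov (h.mild t ht))
    _ ≤ _ := eLpNorm_add_le hmH hmN hq1
    _ ≤ _ := add_le_add ((eLpNorm_norm _).trans_le hH) ((eLpNorm_norm _).trans_le hN)
    _ = _ := by
      rw [← ENNReal.ofReal_add (by positivity) (by positivity)]
      congr 1
      rw [show 1 - (1 / 2 + (d : ℝ) / 2 * (2 / r - 1 / q)) - (1 - d / r) = -gradExp d q by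
        unfold gradExp; field_simp; ring, stepConst]
      ring

theorem ForcedFlow.ae_norm_fderiv_le {d m : ℕ} (hd : 1 ≤ d) {p Λ b r A t : ℝ}
    {u₀ : Ed d → Ed m} {u f : ℝ → Ed d → Ed m} (h : ForcedFlow d m p Λ b u₀ u f) (hp : 1 ≤ p)
    (hΛ : 0 < Λ) (hb : 0 ≤ b) (hr : 2 ≤ r) (hdr : 2 * d < r) (hA : 0 < A) (ht : 0 < t)
    (hu : ∀ s ∈ Set.Ioo 0 t, eLpNorm (fderiv ℝ (u s)) (ENNReal.ofReal r) volume ≤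
      ENNReal.ofReal (A * s ^ (-gradExp d r))) :
    ∀ᵐ x, ‖fderiv ℝ (u t) x‖ ≤ (2 * b + duhamelConst d (1 / 2 + (d : ℝ) / (2 * (r / 2)))
      (1 - d / r) * (Λ * A ^ 2)) * t ^ (-(1 / 2) : ℝ) := by
  have hr0 : 0 < r := by linarith
  have hd0 : (0 : ℝ) < d := by exact_mod_cast hd
  have hdr1 : (d : ℝ) / r < 1 / 2 := by rw [div_lt_iff₀ hr0]; linarith
  have hdr0 : 0 < (d : ℝ) / r := by positivity
  have hF := forcingBound_of_eLpNorm_le hΛ.le hA.le hr0 h.forcing hu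
  have hα : 1 / 2 + (d : ℝ) / (2 * (r / 2)) < 1 := by
    rw [mul_div_cancel₀ _ (two_ne_zero : (2 : ℝ) ≠ 0)]; linarith
  have hN := norm_fderiv_duhamel_le h.measurable (by linarith : 1 ≤ r / 2)
    (by linarith : 1 - (d : ℝ) / r < 1) (by linarith) (by positivity) ht hα hF
  filter_upwards [ae_norm_fderiv_le_add hp hb ht h.besov (h.mild t ht),
    ae_norm_fderiv_heatConv_le hp hb ht h.besov] with x h1 h2
  refine h1.trans ((add_le_add h2.2 (hN x)).trans (le_of_eq ?_))
  rw [show 1 - (1 / 2 + (d : ℝ) / (2 * (r / 2))) - (1 - d / r) = -(1 / 2) by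
    field_simp; ring]
  ring

/-- If, below every time, a continuous function starting under the level `η` can only reach values
under `η`, then it always stays under `η`. -/
theorem lt_of_forall_lt_imp_lt {n : ℝ → ℝ} {η : ℝ} (hn : ContinuousOn n (Set.Ici 0))
    (h0 : n 0 < η) (h : ∀ t, 0 < t → (∀ s ∈ Set.Ioo 0 t, n s ≤ η) → n t < η) {t : ℝ}
    (ht : 0 < t) : n t < η := by
  by_contra! hc
  have hcont : ContinuousOn n (Set.Icc 0 t) := hn.mono Set.Icc_subset_Ici_self
  have hS : IsCompact (Set.Icc 0 t ∩ n ⁻¹' Set.Ici η) :=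
    isCompact_Icc.of_isClosed_subset (hcont.preimage_isClosed_of_isClosed isClosed_Icc isClosed_Ici)
      Set.inter_subset_left
  obtain ⟨t₀, ht₀, hmin⟩ := hS.exists_isLeast ⟨t, ⟨ht.le, le_rfl⟩, hc⟩
  have hpos : 0 < t₀ := by
    refine lt_of_le_of_ne ht₀.1.1 fun he => ?_
    have : η ≤ n t₀ := ht₀.2
    rw [← he] at this
    linarith
  refine absurd (h t₀ hpos fun s hs => ?_) (not_lt.2 ht₀.2)
  by_contra! hs'
  exact absurd (hmin ⟨⟨hs.1.le, hs.2.le.trans ht₀.1.2⟩, hs'.le⟩) (not_le.2 hs.2)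

theorem ForcedFlow.eLpNorm_fderiv_le_of_small {d m : ℕ} (hd : 1 ≤ d) {p Λ b : ℝ}
    {u₀ : Ed d → Ed m} {u f : ℝ → Ed d → Ed m} (h : ForcedFlow d m p Λ b u₀ u f) (hp : (d : ℝ) < p)
    (hp2 : 2 ≤ p) (hΛ : 0 < Λ) (hb : 0 < b) (hsmall : 9 * stepConst d p p * Λ * b < 1)
    {hp1 : 1 ≤ p} (hg : GradContinuousVanishing d m p hp1 u) {t : ℝ} (ht : 0 < t) :
    eLpNorm (fderiv ℝ (u t)) (ENNReal.ofReal p) volume ≤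
      ENNReal.ofReal (3 * b * t ^ (-gradExp d p)) := by
  have hp0 : 0 < p := by linarith
  have : Fact (1 ≤ ENNReal.ofReal p) := ⟨by simpa using ENNReal.ofReal_le_ofReal hp1⟩
  obtain ⟨g, hgc, hg0, hgt⟩ := hg
  have key : ∀ s : ℝ, 0 < s → eLpNorm (fderiv ℝ (u s)) (ENNReal.ofReal p) volume =
      ENNReal.ofReal (‖g s‖ * s ^ (-gradExp d p)) := by
    intro s hs
    have hpos : 0 < s ^ gradExp d p := by positivity
    have h1 : eLpNorm (g s) (ENNReal.ofReal p) volume = ENNReal.ofReal (s ^ gradExp d p) *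
        eLpNorm (fderiv ℝ (u s)) (ENNReal.ofReal p) volume := by
      rw [eLpNorm_congr_ae (hgt s hs), ← Real.enorm_of_nonneg hpos.le]
      exact eLpNorm_const_smul (s ^ gradExp d p) (fderiv ℝ (u s)) _ _
    rw [mul_comm, ENNReal.ofReal_mul (by positivity), ofReal_norm, Lp.enorm_def, h1, ← mul_assoc,
      ← ENNReal.ofReal_mul (by positivity), ← Real.rpow_add hs]
    simp
  have hstep : ∀ s : ℝ, 0 < s → (∀ r ∈ Set.Ioo 0 s, ‖g r‖ ≤ 3 * b) → ‖g s‖ < 3 * b := by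
    intro s hs hlt
    have hα : 1 / 2 + (d : ℝ) / 2 * (2 / p - 1 / p) < 1 := by
      rw [show (d : ℝ) / 2 * (2 / p - 1 / p) = d / p / 2 by field_simp; ring]
      have := (div_lt_one hp0).2 hp
      linarith
    have h1 := h.eLpNorm_fderiv_le hd hp1 le_rfl hΛ hb.le hp2 hp (by linarith) hα
      (by positivity : 0 < 3 * b) hs fun r hr => ?_
    · rw [key s hs, ENNReal.ofReal_le_ofReal_iff'] at h1
      have hpos : 0 < s ^ (-gradExp d p) := by positivity
      rcases h1 with h1 | h1
      · have h2 := le_of_mul_le_mul_right h1 hpos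
        nlinarith
      · have h2 : ‖g s‖ ≤ 0 := nonpos_of_mul_nonpos_left h1 hpos
        linarith
    · have hr0 := hr.1
      rw [key r hr.1]
      gcongr
      exact hlt r hr
  have h2 := lt_of_forall_lt_imp_lt (n := fun s => ‖g s‖) hgc.norm (by simpa [hg0] using hb)
    hstep ht
  rw [key t ht]
  gcongr

/-- The flow with small data satisfies the scale-invariant `L^r` gradient bound, linearly in the size
of the data. -/
def LinearGradBound (d m : ℕ) (p Λ r : ℝ) : Prop :=
  ∃ A : ℝ, 0 < A ∧ ∀ (b : ℝ) (u₀ : Ed d → Ed m) (u f : ℝ → Ed d → Ed m), 0 < b → b ≤ 1 →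
    ForcedFlow d m p Λ b u₀ u f →
    (∀ t : ℝ, 0 < t → eLpNorm (fderiv ℝ (u t)) (ENNReal.ofReal p) volume ≤
      ENNReal.ofReal (3 * b * t ^ (-gradExp d p))) →
    ∀ t : ℝ, 0 < t → eLpNorm (fderiv ℝ (u t)) (ENNReal.ofReal r) volume ≤
      ENNReal.ofReal (A * b * t ^ (-gradExp d r))

theorem LinearGradBound.step {d m : ℕ} (hd : 1 ≤ d) {p Λ r q : ℝ} (hp : (d : ℝ) < p)
    (hp2 : 2 ≤ p) (hΛ : 0 < Λ) (hpr : p ≤ r) (hrq : r ≤ q)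
    (hα : 1 / 2 + (d : ℝ) / 2 * (2 / r - 1 / q) < 1) (h : LinearGradBound d m p Λ r) :
    LinearGradBound d m p Λ q := by
  obtain ⟨A, hA, h⟩ := h
  have hr0 : 0 < r := by linarith
  have hd0 : (0 : ℝ) < d := by exact_mod_cast hd
  have hβ : 1 - (d : ℝ) / r < 1 := by
    have : 0 < (d : ℝ) / r := by positivity
    linarith
  have hS : 0 < stepConst d r q := mul_pos hd0 (duhamelConst_pos hα hβ)
  refine ⟨2 + stepConst d r q * (Λ * A ^ 2), by positivity, ?_⟩
  intro b u₀ u f hb hb1 hF hu t ht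
  refine (hF.eLpNorm_fderiv_le hd (by linarith) (hpr.trans hrq) hΛ hb.le (by linarith)
    (by linarith) (by linarith) hα (by positivity : 0 < A * b) ht
    fun s hs => h b u₀ u f hb hb1 hF hu s hs.1).trans (ENNReal.ofReal_le_ofReal ?_)
  refine mul_le_mul_of_nonneg_right ?_ (by positivity)
  have h1 : b ^ 2 ≤ b := by nlinarith
  have h2 : 0 ≤ stepConst d r q * (Λ * A ^ 2) := by positivity
  nlinarith [mul_le_mul_of_nonneg_left h1 h2]

theorem exists_linearGradBound {d m : ℕ} (hd : 1 ≤ d) {p Λ : ℝ} (hp : (d : ℝ) < p)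
    (hp2 : 2 ≤ p) (hΛ : 0 < Λ) : ∃ r, p ≤ r ∧ 2 * d < r ∧ LinearGradBound d m p Λ r := by
  have hd0 : (0 : ℝ) < d := by exact_mod_cast hd
  have hδ : 0 < 1 / (d : ℝ) - 1 / p := sub_pos.2 (one_div_lt_one_div_of_lt hd0 hp)
  have hiter : ∀ n : ℕ, ∃ r, p ≤ r ∧ LinearGradBound d m p Λ r ∧
      (2 * d < r ∨ (3 / 2 : ℝ) ^ n * (1 / (d : ℝ) - 1 / p) ≤ 1 / (d : ℝ) - 1 / r) := by
    intro n
    induction n with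
    | zero =>
      exact ⟨p, le_rfl, ⟨3, by norm_num, fun b u₀ u f _ _ _ hu t ht => hu t ht⟩, Or.inr (by simp)⟩
    | succ n ih =>
      obtain ⟨r, hpr, hr, h⟩ := ih
      by_cases hr2 : 2 * d < r
      · exact ⟨r, hpr, hr, Or.inl hr2⟩
      have hδr := h.resolve_left hr2
      rw [not_lt] at hr2
      have hr0 : 0 < r := by linarith
      set δ := 1 / (d : ℝ) - 1 / r with hδ_def
      have hδ0 : 0 < δ := sub_pos.2 (one_div_lt_one_div_of_lt hd0 (by linarith))
      have hδ1 : 2 * δ ≤ 1 / (d : ℝ) := by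
        have h1 : 1 / (2 * (d : ℝ)) ≤ 1 / r := one_div_le_one_div_of_le hr0 hr2
        have h2 : 1 / (2 * (d : ℝ)) = 1 / (d : ℝ) / 2 := by field_simp
        linarith
      have hq : 0 < 1 / (d : ℝ) - 3 / 2 * δ := by
        have : 0 < 1 / (d : ℝ) := by positivity
        linarith
      have hqr : 1 / r = 1 / (d : ℝ) - δ := by rw [hδ_def]; ring
      refine ⟨(1 / (d : ℝ) - 3 / 2 * δ)⁻¹, ?_, ?_, Or.inr ?_⟩
      · refine hpr.trans ?_
        rw [le_inv_comm₀ hr0 hq, ← one_div]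
        linarith
      · refine hr.step hd hp hp2 hΛ hpr ?_ ?_
        · rw [le_inv_comm₀ hr0 hq, ← one_div]
          linarith
        · rw [one_div (_ : ℝ)⁻¹, inv_inv, show 2 / r = 2 * (1 / r) by ring, hqr]
          have e : (d : ℝ) / 2 * (2 * (1 / (d : ℝ) - δ) - (1 / d - 3 / 2 * δ)) =
            1 / 2 - d * δ / 4 := by field_simp; ring
          rw [e]
          have : 0 < d * δ := by positivity
          linarith
      · rw [one_div (_ : ℝ)⁻¹, inv_inv, pow_succ]
        linarith
  obtain ⟨n, hn⟩ := pow_unbounded_of_one_lt (1 / (d : ℝ) / (1 / (d : ℝ) - 1 / p))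
    (by norm_num : (1 : ℝ) < 3 / 2)
  obtain ⟨r, hpr, hr, h | h⟩ := hiter n
  · exact ⟨r, hpr, h, hr⟩
  · rw [div_lt_iff₀ hδ] at hn
    have : 0 < 1 / r := by
      have : 0 < r := by linarith
      positivity
    linarith

theorem exists_ae_norm_fderiv_le {d m : ℕ} (hd : 1 ≤ d) {p Λ : ℝ} (hp : (d : ℝ) < p)
    (hp2 : 2 ≤ p) (hΛ : 0 < Λ) :
    ∃ A : ℝ, 0 < A ∧ ∀ (b : ℝ) (u₀ : Ed d → Ed m) (u f : ℝ → Ed d → Ed m), 0 < b → b ≤ 1 →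
      ForcedFlow d m p Λ b u₀ u f →
      (∀ t : ℝ, 0 < t → eLpNorm (fderiv ℝ (u t)) (ENNReal.ofReal p) volume ≤
        ENNReal.ofReal (3 * b * t ^ (-gradExp d p))) →
      ∀ t : ℝ, 0 < t → ∀ᵐ x, ‖fderiv ℝ (u t) x‖ ≤ A * b * t ^ (-(1 / 2) : ℝ) := by
  obtain ⟨r, hpr, hdr, A, hA, h⟩ := exists_linearGradBound (m := m) hd hp hp2 hΛ
  have hr0 : 0 < r := by linarith
  have hd0 : (0 : ℝ) < d := by exact_mod_cast hd
  have hdr1 : (d : ℝ) / r < 1 / 2 := by rw [div_lt_iff₀ hr0]; linarith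
  have hdr0 : 0 < (d : ℝ) / r := by positivity
  have hS : 0 < duhamelConst d (1 / 2 + (d : ℝ) / (2 * (r / 2))) (1 - d / r) := by
    refine duhamelConst_pos ?_ (by linarith)
    rw [mul_div_cancel₀ _ (two_ne_zero : (2 : ℝ) ≠ 0)]
    linarith
  refine ⟨2 + duhamelConst d (1 / 2 + (d : ℝ) / (2 * (r / 2))) (1 - d / r) * (Λ * A ^ 2),
    by positivity, fun b u₀ u f hb hb1 hF hu t ht => ?_⟩
  filter_upwards [hF.ae_norm_fderiv_le hd (by linarith) hΛ hb.le (by linarith) hdr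
    (by positivity : 0 < A * b) ht fun s hs => h b u₀ u f hb hb1 hF hu s hs.1] with x hx
  refine hx.trans (mul_le_mul_of_nonneg_right ?_ (by positivity))
  have h1 : b ^ 2 ≤ b := by nlinarith
  generalize duhamelConst d (1 / 2 + (d : ℝ) / (2 * (r / 2))) (1 - d / r) = S at hS
  have h2 : 0 ≤ S * (Λ * A ^ 2) := by positivity
  nlinarith [mul_le_mul_of_nonneg_left h1 h2]

theorem setLIntegral_ball_sq_le {d : ℕ} {F : Type*} [NormedAddCommGroup F] {p R L : ℝ}
    (hd : 1 ≤ d) (hp : 2 ≤ p) (hR : 0 < R) (hL : 0 ≤ L) {w : Ed d → F}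
    (hw : AEStronglyMeasurable w volume)
    (h : eLpNorm w (ENNReal.ofReal p) volume ≤ ENNReal.ofReal L) (x : Ed d) :
    ∫⁻ y in Metric.ball x R, ‖w y‖ₑ ^ (2 : ℝ) ≤
      ENNReal.ofReal (L ^ 2 * (R ^ d * volume.real (Metric.ball (0 : Ed d) 1)) ^ (1 - 2 / p)) := by
  have hp0 : 0 < p := by linarith
  have : Nonempty (Fin d) := ⟨⟨0, hd⟩⟩
  have hV : volume (Metric.ball x R) =
      ENNReal.ofReal (R ^ d * volume.real (Metric.ball (0 : Ed d) 1)) := by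
    rw [Measure.addHaar_ball _ _ hR.le, ENNReal.ofReal_mul (by positivity),
      ofReal_measureReal, finrank_euclideanSpace_fin]
  have hexp : 0 ≤ 1 / 2 - 1 / p := sub_nonneg.2 (one_div_le_one_div_of_le two_pos hp)
  have hv0 : 0 ≤ R ^ d * volume.real (Metric.ball (0 : Ed d) 1) := by positivity
  have h1 := eLpNorm_le_eLpNorm_mul_rpow_measure_univ (μ := volume.restrict (Metric.ball x R))
    (ENNReal.ofReal_le_ofReal hp) hw.restrict
  rw [Measure.restrict_apply_univ, hV, ENNReal.toReal_ofReal two_pos.le,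
    ENNReal.toReal_ofReal hp0.le, ENNReal.ofReal_rpow_of_nonneg hv0 hexp] at h1
  have h2 := h1.trans (mul_le_mul_left ((eLpNorm_mono_measure w Measure.restrict_le_self).trans h) _)
  rw [eLpNorm_ofReal_le_iff two_pos, ← ENNReal.ofReal_mul hL,
    ENNReal.ofReal_rpow_of_nonneg (by positivity) two_pos.le] at h2
  refine h2.trans (le_of_eq ?_)
  rw [Real.mul_rpow hL (by positivity), ← Real.rpow_mul hv0, Real.rpow_two]
  congr 3
  ring

theorem cylinderL2_le {d : ℕ} {F : Type} [NormedAddCommGroup F] {p b R : ℝ} (hd : 1 ≤ d)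
    (hp : 2 ≤ p) (hR : 0 < R) (hb : 0 ≤ b) {w : ℝ → Ed d → F}
    (hw : ∀ s, AEStronglyMeasurable (w s) volume)
    (h : ∀ s : ℝ, 0 < s → eLpNorm (w s) (ENNReal.ofReal p) volume ≤
      ENNReal.ofReal (b * s ^ (-gradExp d p))) (x : Ed d) :
    cylinderL2 d w x R ≤ ENNReal.ofReal (b * R ^ ((d : ℝ) / 2) *
      (volume.real (Metric.ball (0 : Ed d) 1) ^ (1 - 2 / p) * (p / d)) ^ ((1 : ℝ) / 2)) := by
  have hp0 : 0 < p := by linarith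
  have hd0 : (0 : ℝ) < d := by exact_mod_cast hd
  have hdp : 0 < (d : ℝ) / p := by positivity
  set V := volume.real (Metric.ball (0 : Ed d) 1) with hV
  have hV0 : 0 ≤ V := measureReal_nonneg
  have hc : 0 ≤ b ^ 2 * (R ^ d * V) ^ (1 - 2 / p) := by positivity
  suffices H : eLpNorm (fun q : ℝ × Ed d => w q.1 q.2) (ENNReal.ofReal 2)
      ((volume.restrict (Set.Ioo 0 (R ^ 2))).prod (volume.restrict (Metric.ball x R))) ≤ _ by
    rwa [ENNReal.ofReal_ofNat] at H
  rw [eLpNorm_ofReal_le_iff two_pos]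
  calc _ ≤ ∫⁻ s in Set.Ioo 0 (R ^ 2), ∫⁻ y in Metric.ball x R, ‖w s y‖ₑ ^ (2 : ℝ) :=
        lintegral_prod_le _
    _ ≤ ∫⁻ s in Set.Ioo 0 (R ^ 2), ENNReal.ofReal (b ^ 2 * (R ^ d * V) ^ (1 - 2 / p)) *
          ENNReal.ofReal (s ^ (-(1 - d / p))) := by
        refine setLIntegral_mono' measurableSet_Ioo fun s hs => ?_
        have hs0 := hs.1
        refine (setLIntegral_ball_sq_le hd hp hR (by positivity) (hw s) (h s hs0) x).trans
          (le_of_eq ?_)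
        rw [← ENNReal.ofReal_mul hc]
        congr 1
        rw [mul_pow, ← Real.rpow_two (s ^ _), ← Real.rpow_mul hs0.le, mul_right_comm]
        congr 2
        unfold gradExp
        field_simp
    _ = ENNReal.ofReal (b ^ 2 * (R ^ d * V) ^ (1 - 2 / p)) *
          ENNReal.ofReal ((R ^ 2) ^ (1 - (1 - d / p)) / (1 - (1 - d / p))) := by
        rw [lintegral_const_mul _ (by fun_prop),
          lintegral_Ioo_rpow_neg (by linarith) (by positivity)]
    _ = _ := by
        rw [← ENNReal.ofReal_mul hc, ENNReal.ofReal_rpow_of_nonneg (by positivity) two_pos.le]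
        congr 1
        rw [sub_sub_cancel, Real.mul_rpow (by positivity) hV0,
          Real.mul_rpow (by positivity) (by positivity), ← Real.rpow_mul (by positivity),
          Real.mul_rpow hb (by positivity), ← Real.rpow_natCast R d, ← Real.rpow_natCast R 2,
          ← Real.rpow_mul hR.le, ← Real.rpow_mul hR.le, ← Real.rpow_mul hR.le, Real.rpow_two b]
        norm_num
        have e : R ^ ((d : ℝ) * (1 - 2 / p)) * R ^ (2 * ((d : ℝ) / p)) = R ^ (d : ℝ) := by
          rw [← Real.rpow_add hR]; congr 1; field_simp; ring
        rw [← Real.rpow_natCast R d, ← e]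
        field_simp

theorem iSup_gradient_add_iSup_cylinder_le {d m : ℕ} {p A b : ℝ} (hd : 1 ≤ d) (hp : 2 ≤ p)
    (hA : 0 < A) (hb : 0 < b) {u : ℝ → Ed d → Ed m}
    (h : ∀ t : ℝ, 0 < t → eLpNorm (fderiv ℝ (u t)) (ENNReal.ofReal p) volume ≤
      ENNReal.ofReal (3 * b * t ^ (-gradExp d p)))
    (hinf : ∀ t : ℝ, 0 < t → ∀ᵐ x, ‖fderiv ℝ (u t) x‖ ≤ A * b * t ^ (-(1 / 2) : ℝ)) :
    (⨆ t : Set.Ioi (0 : ℝ), ENNReal.ofReal ((t : ℝ) ^ ((1 : ℝ) / 2)) *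
        eLpNorm (fun x => fderiv ℝ (u (t : ℝ)) x) ⊤ volume) +
      (⨆ x : Ed d, ⨆ R : Set.Ioi (0 : ℝ), ENNReal.ofReal ((R : ℝ) ^ (-(d : ℝ) / 2)) *
        cylinderL2 d (fun s y => fderiv ℝ (u s) y) x (R : ℝ)) ≤
      ENNReal.ofReal (A + 3 * (volume.real (Metric.ball (0 : Ed d) 1) ^ (1 - 2 / p) *
        (p / d)) ^ ((1 : ℝ) / 2)) * ENNReal.ofReal b := by
  have hp0 : 0 < p := by linarith
  set W := (volume.real (Metric.ball (0 : Ed d) 1) ^ (1 - 2 / p) * (p / d)) ^ ((1 : ℝ) / 2) with hW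
  have hW0 : 0 ≤ W := by positivity
  rw [ENNReal.ofReal_add hA.le (by positivity), add_mul, ← ENNReal.ofReal_mul hA.le,
    ← ENNReal.ofReal_mul (by positivity)]
  refine add_le_add (iSup_le fun t => ?_) (iSup_le fun x => iSup_le fun R => ?_)
  · have ht : 0 < (t : ℝ) := t.2
    have h1 : eLpNorm (fun x => fderiv ℝ (u (t : ℝ)) x) ⊤ volume ≤
        ENNReal.ofReal (A * b * (t : ℝ) ^ (-(1 / 2) : ℝ)) := by
      rw [eLpNorm_exponent_top]
      exact eLpNormEssSup_le_of_ae_bound (hinf t ht)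
    refine (mul_le_mul_right h1 _).trans (le_of_eq ?_)
    rw [← ENNReal.ofReal_mul (by positivity), mul_left_comm, ← Real.rpow_add ht]
    norm_num
  · have hR : 0 < (R : ℝ) := R.2
    have h1 := cylinderL2_le hd hp hR (by positivity : 0 ≤ 3 * b)
      (fun s => (measurable_fderiv ℝ (u s)).aestronglyMeasurable) h x
    refine (mul_le_mul_right h1 _).trans (le_of_eq ?_)
    rw [← ENNReal.ofReal_mul (by positivity)]
    congr 1
    have e : (R : ℝ) ^ (-(d : ℝ) / 2) * (R : ℝ) ^ ((d : ℝ) / 2) = 1 := by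
      rw [← Real.rpow_add hR]; ring_nf; simp
    calc _ = 3 * W * b * ((R : ℝ) ^ (-(d : ℝ) / 2) * (R : ℝ) ^ ((d : ℝ) / 2)) := by ring
      _ = _ := by rw [e, mul_one]

theorem le_mul_of_forall_ofReal_le {L C N : ℝ≥0∞} {ε : ℝ} (hC : C ≠ ∞)
    (hN : N < ENNReal.ofReal ε)
    (h : ∀ b : ℝ, 0 < b → b < ε → N ≤ ENNReal.ofReal b → L ≤ C * ENNReal.ofReal b) :
    L ≤ C * N := by
  have hcont : ContinuousWithinAt (fun b => C * b) (Set.Ioi N) N :=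
    (ENNReal.continuous_const_mul hC).continuousWithinAt
  have : (nhdsWithin N (Set.Ioi N)).NeBot :=
    nhdsGT_neBot_of_exists_gt ⟨_, hN⟩
  refine ge_of_tendsto hcont ?_
  filter_upwards [Ioo_mem_nhdsGT hN] with b hb
  have hbt : b ≠ ∞ := (hb.2.trans ENNReal.ofReal_lt_top).ne
  have hb0 : b ≠ 0 := (bot_le.trans_lt hb.1).ne'
  have h1 := h b.toReal (ENNReal.toReal_pos hb0 hbt)
    ((ENNReal.lt_ofReal_iff_toReal_lt hbt).1 hb.2)
  rw [ENNReal.ofReal_toReal hbt] at h1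
  exact h1 hb.1.le

theorem stepConst_pos {d : ℕ} (hd : 1 ≤ d) {p : ℝ} (hp : (d : ℝ) < p) : 0 < stepConst d p p := by
  have hd0 : (0 : ℝ) < d := by exact_mod_cast hd
  have hp0 : 0 < p := hd0.trans hp
  have h1 : (d : ℝ) / p < 1 := (div_lt_one hp0).2 hp
  have h2 : 0 < (d : ℝ) / p := by positivity
  refine mul_pos hd0 (duhamelConst_pos ?_ (by linarith))
  rw [show (d : ℝ) / 2 * (2 / p - 1 / p) = d / p / 2 by field_simp; ring]
  linarith

/-- for small Besov data, every mild solution satisfies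
`sup_{t>0} t^{1/2}‖∇u(t)‖_{L^∞} + sup_x sup_{R>0} R^{-d/2}‖∇u‖_{L²(B_R(x)×(0,R²))}
  ≤ C‖u₀‖_{Ḃ^{d/p}_{p,∞}}`. -/
theorem besov_small_data_X_bound (d m : ℕ) (hd : 1 ≤ d) (hm : 1 ≤ m) (p : ℝ)
    (hp : (d : ℝ) < p) (hp2 : 2 ≤ p) (Λ : ℝ) (hΛ : 0 < Λ) :
    ∃ ε C : ℝ, 0 < ε ∧ 0 < C ∧
      ∀ (u₀ : Ed d → Ed m) (u : ℝ → Ed d → Ed m),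
        besovNorm d m p u₀ < ENNReal.ofReal ε →
        IsMildSolution d m Λ u₀ u →
        GradContinuousVanishing d m p
          (le_of_lt (lt_of_le_of_lt (by exact_mod_cast hd) hp)) u →
        (⨆ t : Set.Ioi (0 : ℝ),
            ENNReal.ofReal ((t : ℝ) ^ ((1 : ℝ) / 2)) *
              eLpNorm (fun x => fderiv ℝ (u (t : ℝ)) x) ⊤ volume) +
          (⨆ x : Ed d, ⨆ R : Set.Ioi (0 : ℝ),
            ENNReal.ofReal ((R : ℝ) ^ (-(d : ℝ) / 2)) *
              cylinderL2 d (fun s y => fderiv ℝ (u s) y) x (R : ℝ)) ≤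
          ENNReal.ofReal C * besovNorm d m p u₀ := by
  obtain ⟨A, hA, hinf⟩ := exists_ae_norm_fderiv_le (m := m) hd hp hp2 hΛ
  have hp0 : 0 < p := by linarith
  have hS := stepConst_pos hd hp
  refine ⟨min 1 (9 * stepConst d p p * Λ)⁻¹, A + 3 * (volume.real (Metric.ball (0 : Ed d) 1) ^
    (1 - 2 / p) * (p / d)) ^ ((1 : ℝ) / 2), by positivity, by positivity, ?_⟩
  rintro u₀ u hN ⟨f, hf, hforce, hmild⟩ hg
  refine le_mul_of_forall_ofReal_le ENNReal.ofReal_ne_top hN fun b hb hbε hNb => ?_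
  have hF : ForcedFlow d m p Λ b u₀ u f := ⟨hf, hforce, hmild, hNb⟩
  have hsmall : 9 * stepConst d p p * Λ * b < 1 := by
    have h1 := mul_lt_mul_of_pos_left (hbε.trans_le (min_le_right _ _))
      (by positivity : 0 < 9 * stepConst d p p * Λ)
    rwa [mul_inv_cancel₀ (by positivity)] at h1
  have hu : ∀ t : ℝ, 0 < t → eLpNorm (fderiv ℝ (u t)) (ENNReal.ofReal p) volume ≤
      ENNReal.ofReal (3 * b * t ^ (-gradExp d p)) :=
    fun t ht => hF.eLpNorm_fderiv_le_of_small hd hp hp2 hΛ hb hsmall hg ht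
  exact iSup_gradient_add_iSup_cylinder_le hd hp2 hA hb hu
    (hinf b u₀ u f hb (hbε.le.trans (min_le_left _ _)) hF hu)
end
end

section
/- Let C₁, C₂ > 0 and ε > 0, and let g : [0,∞) → [0,∞) be a continuous function with g(0) ≤ C₁ such that g(t) ≤ C₁ + C₂ ε (1 + log(1+t)) g(t)² for all t ≥ 0. Then g(t) ≤ 2C₁ for all t ≥ 0 satisfying 1 + t ≤ exp(1/(4C₁C₂ε) - 1). -/
noncomputable section

open Real Set

/-- the continuity (bootstrap) argument on exponentially long time scales:
if a continuous nonnegative `g` on `[0,∞)` satisfies `g(0) ≤ C₁` and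
`g(t) ≤ C₁ + C₂ ε (1 + log(1+t)) g(t)²`, then `g(t) ≤ 2C₁` as long as
`1 + t ≤ exp(1/(4C₁C₂ε) - 1)`. -/
theorem bootstrap_log (C₁ C₂ ε : ℝ) (hC₁ : 0 < C₁) (hC₂ : 0 < C₂) (hε : 0 < ε)
    (g : ℝ → ℝ) (hcont : ContinuousOn g (Set.Ici 0))
    (hnonneg : ∀ t : ℝ, 0 ≤ t → 0 ≤ g t)
    (h0 : g 0 ≤ C₁)
    (hineq : ∀ t : ℝ, 0 ≤ t →
      g t ≤ C₁ + C₂ * ε * (1 + Real.log (1 + t)) * (g t) ^ 2) :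
    ∀ t : ℝ, 0 ≤ t → 1 + t ≤ Real.exp (1 / (4 * C₁ * C₂ * ε) - 1) → g t ≤ 2 * C₁ := by
  intro t ht hT
  by_contra! hgt
  obtain ⟨s, ⟨hs0, hst⟩, hgs⟩ : 2 * C₁ ∈ g '' Set.Icc 0 t :=
    intermediate_value_Icc ht (hcont.mono Set.Icc_subset_Ici_self) ⟨by linarith, hgt.le⟩
  have hst' : s < t := lt_of_le_of_ne hst (by rintro rfl; linarith)
  have hlog : Real.log (1 + s) < 1 / (4 * C₁ * C₂ * ε) - 1 :=
    (Real.log_lt_iff_lt_exp (by linarith)).2 (by linarith)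
  have hcoef : (1 + Real.log (1 + s)) * (4 * C₁ * C₂ * ε) < 1 :=
    (lt_div_iff₀ (by positivity)).1 (by linarith)
  have hs := hineq s hs0
  rw [hgs] at hs
  nlinarith [mul_lt_mul_of_pos_left hcoef hC₁]
end
end
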